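/- Let ψ be an admissible obstacle and let γ₀ ∈ P_ψ. Then there exists a ∩-shaped pseudograph γ ∈ B_{γ₀} above γ₀ whose graph reparametrization u is concave, and which satisfies E(γ) ≤ E(γ₀) and L(γ) ≤ L(γ₀); in particular E_ε(γ) ≤ E_ε(γ₀) for every ε ≥ 0. -/

import Mathlib

open MeasureTheory Set Topology Filter

noncomputable section

/-- A function of class `W^{2,2}(0,1)`, identified with its `C¹([0,1])` representative:
`u` has weak derivatives `du`, `ddu` (encoded through the fundamental theorem of calculus)
with `du, ddu ∈ L¹(0,1)` and `ddu ∈ L²(0,1)`. -/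
structure W22 where
  u : ℝ → ℝ
  du : ℝ → ℝ
  ddu : ℝ → ℝ
  du_int : IntegrableOn du (Icc (0:ℝ) 1)
  ddu_int : IntegrableOn ddu (Icc (0:ℝ) 1)
  ddu_sq : IntegrableOn (fun x => (ddu x)^2) (Icc (0:ℝ) 1)
  ftc_u : ∀ x ∈ Icc (0:ℝ) 1, u x = u 0 + ∫ s in (0:ℝ)..x, du s
  ftc_du : ∀ x ∈ Icc (0:ℝ) 1, du x = du 0 + ∫ s in (0:ℝ)..x, ddu s

/-- The elastic energy of a graph. -/
def graphE (f : W22) : ℝ :=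
  ∫ x in Ioo (0:ℝ) 1, (f.ddu x)^2 / (1 + (f.du x)^2) ^ ((5:ℝ)/2)

/-- The length of a graph. -/
def graphLen (f : W22) : ℝ :=
  ∫ x in Ioo (0:ℝ) 1, Real.sqrt (1 + (f.du x)^2)

/-- The length-penalized elastic energy of a graph. -/
def graphPE (ε : ℝ) (f : W22) : ℝ := graphE f + ε * graphLen f

/-- Membership in the admissible class `G_ψ`. -/
def MemG (ψ : ℝ → ℝ) (f : W22) : Prop :=
  f.u 0 = 0 ∧ f.u 1 = 0 ∧ ∀ x ∈ Icc (0:ℝ) 1, ψ x ≤ f.u x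

/-- An admissible obstacle. -/
structure Admissible (ψ : ℝ → ℝ) : Prop where
  cont : ContinuousOn ψ (Icc 0 1)
  neg0 : ψ 0 < 0
  neg1 : ψ 1 < 0
  pos : ∃ x ∈ Icc (0:ℝ) 1, 0 < ψ x
  osd : ∃ C : ℝ, ∀ x ∈ Ioo (0:ℝ) 1,
      (∃ d : ℝ, |d| ≤ C ∧ HasDerivWithinAt ψ d (Ici x) x) ∧
      (∃ d : ℝ, |d| ≤ C ∧ HasDerivWithinAt ψ d (Iic x) x)

/-- `‖ψ'‖_∞`, the smallest uniform bound for the one-sided derivatives of `ψ` on `(0,1)`. -/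
def obstNorm (ψ : ℝ → ℝ) : ℝ :=
  sInf {C : ℝ | 0 ≤ C ∧ ∀ x ∈ Ioo (0:ℝ) 1, ∀ d : ℝ,
    (HasDerivWithinAt ψ d (Ici x) x ∨ HasDerivWithinAt ψ d (Iic x) x) → |d| ≤ C}

/-- A planar curve on `(0,1)` of class `W^{1,1}((0,1);ℝ²)`. -/
structure Curve1 where
  x : ℝ → ℝ
  y : ℝ → ℝ
  dx : ℝ → ℝ
  dy : ℝ → ℝ
  dx_int : IntegrableOn dx (Icc (0:ℝ) 1)
  dy_int : IntegrableOn dy (Icc (0:ℝ) 1)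
  ftc_x : ∀ t ∈ Icc (0:ℝ) 1, x t = x 0 + ∫ s in (0:ℝ)..t, dx s
  ftc_y : ∀ t ∈ Icc (0:ℝ) 1, y t = y 0 + ∫ s in (0:ℝ)..t, dy s

/-- A planar curve of class `W^{1,1}((0,1);ℝ²) ∩ W^{2,1}_loc((0,1);ℝ²)`. -/
structure Curve extends Curve1 where
  ddx : ℝ → ℝ
  ddy : ℝ → ℝ
  ddx_loc : ∀ a b : ℝ, 0 < a → b < 1 → IntegrableOn ddx (Icc a b)
  ddy_loc : ∀ a b : ℝ, 0 < a → b < 1 → IntegrableOn ddy (Icc a b)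
  ftc_dx : ∀ a ∈ Ioo (0:ℝ) 1, ∀ t ∈ Ioo (0:ℝ) 1, dx t = dx a + ∫ s in a..t, ddx s
  ftc_dy : ∀ a ∈ Ioo (0:ℝ) 1, ∀ t ∈ Ioo (0:ℝ) 1, dy t = dy a + ∫ s in a..t, ddy s

/-- `|γ'(t)|`. -/
def speed1 (γ : Curve1) (t : ℝ) : ℝ := Real.sqrt ((γ.dx t)^2 + (γ.dy t)^2)

/-- The length `L(γ) = ∫₀¹ |γ'| dt`, as an extended real number. -/
def len1E (γ : Curve1) : ENNReal := ∫⁻ t in Ioo (0:ℝ) 1, ENNReal.ofReal (speed1 γ t)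

/-- The length `L(γ)`, as a real number. -/
def len1 (γ : Curve1) : ℝ := ∫ t in Ioo (0:ℝ) 1, speed1 γ t

def lenE (γ : Curve) : ENNReal := len1E γ.toCurve1

/-- The integrand `⟨γ'', N_γ⟩²/|γ'|³` of the elastic energy. -/
def elInt (γ : Curve) (t : ℝ) : ℝ :=
  (γ.dx t * γ.ddy t - γ.dy t * γ.ddx t)^2 / ((γ.dx t)^2 + (γ.dy t)^2) ^ ((5:ℝ)/2)

/-- Elastic energy of a curve, as an extended real number. -/
def elE (γ : Curve) : ENNReal := ∫⁻ t in Ioo (0:ℝ) 1, ENNReal.ofReal (elInt γ t)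

/-- The length-penalized elastic energy `E_ε = E + ε·L`. -/
def penE (ε : ℝ) (γ : Curve) : ENNReal := elE γ + ENNReal.ofReal ε * lenE γ

/-- A curve is immersed if `|γ'| > ε` on `(0,1)` for some `ε > 0`. -/
def Curve.Immersed (γ : Curve) : Prop :=
  ∃ ε > 0, ∀ t ∈ Ioo (0:ℝ) 1, ε < speed1 γ.toCurve1 t

/-- `u` lies in `W^{2,2}_loc(c,d)` with weak derivatives `du`, `ddu`. -/
structure W22locOn (u du ddu : ℝ → ℝ) (c d : ℝ) : Prop where
  du_loc : ∀ a b : ℝ, c < a → b < d → IntegrableOn du (Icc a b)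
  ddu_loc : ∀ a b : ℝ, c < a → b < d → IntegrableOn ddu (Icc a b)
  ddu_sq : ∀ a b : ℝ, c < a → b < d → IntegrableOn (fun t => (ddu t)^2) (Icc a b)
  ftc_u : ∀ a ∈ Ioo c d, ∀ t ∈ Ioo c d, u t = u a + ∫ s in a..t, du s
  ftc_du : ∀ a ∈ Ioo c d, ∀ t ∈ Ioo c d, du t = du a + ∫ s in a..t, ddu s

/-- `γ` is a pseudograph. -/
def Pseudograph (γ : Curve) : Prop :=
  γ.Immersed ∧ (∀ t ∈ Ioo (0:ℝ) 1, 0 ≤ γ.dx t) ∧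
  ∀ a b : ℝ, 0 ≤ a → a < b → b ≤ 1 → (∀ t ∈ Ioo a b, 0 < γ.dx t) →
    ∃ u du ddu : ℝ → ℝ, W22locOn u du ddu (γ.x a) (γ.x b) ∧
      ∀ t ∈ Ioo a b, u (γ.x t) = γ.y t

/-- Membership in `P_ψ`. -/
def MemP (ψ : ℝ → ℝ) (γ : Curve) : Prop :=
  Pseudograph γ ∧ γ.x 0 = 0 ∧ γ.y 0 = 0 ∧ γ.x 1 = 1 ∧ γ.y 1 = 0 ∧
  ∀ t ∈ Icc (0:ℝ) 1, ψ (γ.x t) ≤ γ.y t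

/-- `v : (a,b) → (c,d)` is invertible in `W^{1,1}` (increasing case): it has an
inverse `w` which is again of class `W^{1,1}`. -/
def InvertibleW11On (v : ℝ → ℝ) (a b c d : ℝ) : Prop :=
  ∃ w dw : ℝ → ℝ, IntegrableOn dw (Icc c d) ∧
    (∀ s ∈ Icc c d, w s = w c + ∫ r in c..s, dw r) ∧
    (∀ t ∈ Ioo a b, v t ∈ Ioo c d ∧ w (v t) = t) ∧
    (∀ s ∈ Ioo c d, w s ∈ Ioo a b ∧ v (w s) = s)

/-- `γ ∈ M_{γ₀}`: a `∩`-shaped curve above `γ₀` with parameters `β₁, β₂` and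
graph reparametrization `u`. -/
structure CapAbove (γ : Curve1) (γ₀ : Curve) (β₁ β₂ : ℝ) (u : ℝ → ℝ) : Prop where
  ep0 : γ.x 0 = 0 ∧ γ.y 0 = 0
  ep1 : γ.x 1 = 1 ∧ γ.y 1 = 0
  hβ : 0 ≤ β₁ ∧ β₁ < β₂ ∧ β₂ ≤ 1
  left : ∀ t ∈ Icc (0:ℝ) β₁, γ.x t = 0
  right : ∀ t ∈ Icc β₂ (1:ℝ), γ.x t = 1
  inv : InvertibleW11On γ.x β₁ β₂ 0 1
  graph : ∀ t ∈ Ioo β₁ β₂, u (γ.x t) = γ.y t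
  ucont : ContinuousOn u (Icc (0:ℝ) 1)
  above : ∀ t ∈ Icc (0:ℝ) 1, γ₀.y t ≤ u (γ₀.x t)

/-- A `∩`-shaped pseudograph with parameters `β₁, β₂` and graph reparametrization `u`
(with weak derivatives `du`, `ddu`). -/
structure CapShaped (γ : Curve) (β₁ β₂ : ℝ) (u du ddu : ℝ → ℝ) : Prop where
  hβ : 0 ≤ β₁ ∧ β₁ < β₂ ∧ β₂ ≤ 1
  left : ∀ t ∈ Icc (0:ℝ) β₁, γ.x t = 0
  right : ∀ t ∈ Icc β₂ (1:ℝ), γ.x t = 1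
  pos : ∀ t ∈ Ioo β₁ β₂, 0 < γ.dx t
  graph : ∀ t ∈ Ioo β₁ β₂, u (γ.x t) = γ.y t
  reg : W22locOn u du ddu 0 1

/-- `G(x) = ∫₀ˣ (1+s²)^{-5/4} ds`. -/
def Gfun (x : ℝ) : ℝ := ∫ s in (0:ℝ)..x, ((1 + s^2) ^ (-(5:ℝ)/4) : ℝ)

/-- `c₀ = ∫_ℝ (1+s²)^{-5/4} ds`. -/
def c0 : ℝ := ∫ s : ℝ, ((1 + s^2) ^ (-(5:ℝ)/4) : ℝ)

/-- The inverse of `G`. -/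
def Ginv : ℝ → ℝ := Function.invFun Gfun

/-- The ratio `R(B)` from the nonexistence theorem. -/
def ratio (B : ℝ) : ℝ :=
  (∫ t in (0:ℝ)..B, t / (Real.sqrt (B - t) * (1 + t^2) ^ ((5:ℝ)/4))) /
  (2 * ∫ t in (0:ℝ)..B, 1 / (Real.sqrt (B - t) * (1 + t^2) ^ ((5:ℝ)/4)))

/-- The symmetric cone obstacle with valley `[0,s]` and peak `A`. -/
def coneObstacle (A s : ℝ) : ℝ → ℝ := fun x =>
  if x ≤ 1/2 then A / (1/2 - s) * (x - s) else A / (1/2 - s) * (1 - s - x)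
/-! ### Absolutely continuous functions -/

theorem AbsolutelyContinuousOnInterval.of_dist_le {f g : ℝ → ℝ} {a b : ℝ}
    (hg : AbsolutelyContinuousOnInterval g a b)
    (h : ∀ x ∈ uIcc a b, ∀ y ∈ uIcc a b, dist (f x) (f y) ≤ dist (g x) (g y)) :
    AbsolutelyContinuousOnInterval f a b := by
  rw [absolutelyContinuousOnInterval_iff] at hg ⊢
  intro ε hε
  obtain ⟨δ, hδ, H⟩ := hg ε hε
  refine ⟨δ, hδ, fun E hE hlen => lt_of_le_of_lt ?_ (H E hE hlen)⟩
  exact Finset.sum_le_sum fun i hi => h _ (hE.1 i hi).1 _ (hE.1 i hi).2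

theorem AbsolutelyContinuousOnInterval.comp_orderIso {f : ℝ → ℝ} {a b K : ℝ} (e : ℝ ≃o ℝ)
    (he : ∀ s t, dist (e s) (e t) ≤ K * dist s t)
    (hf : AbsolutelyContinuousOnInterval f (e a) (e b)) :
    AbsolutelyContinuousOnInterval (fun t => f (e t)) a b := by
  have hK : 0 ≤ K := by
    have := he 0 1
    have h1 : 0 ≤ dist (e 0) (e 1) := dist_nonneg
    simp at this
    linarith
  rw [absolutelyContinuousOnInterval_iff] at hf ⊢
  intro ε hε
  obtain ⟨δ, hδ, H⟩ := hf ε hε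
  refine ⟨δ / (K + 1), by positivity, fun E hE hlen => ?_⟩
  refine H (E.1, fun i => (e (E.2 i).1, e (E.2 i).2)) ⟨?_, ?_⟩ ?_
  · intro i hi
    have key : ∀ t ∈ uIcc a b, e t ∈ uIcc (e a) (e b) := by
      intro t ht
      rw [mem_uIcc] at ht ⊢
      simpa using ht
    exact ⟨key _ (hE.1 i hi).1, key _ (hE.1 i hi).2⟩
  · intro i hi j hj hij
    have := hE.2 hi hj hij
    simp only [Function.onFun] at this ⊢
    have key : ∀ s t : ℝ, uIoc (e s) (e t) = e '' uIoc s t := by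
      intro s t
      ext z
      obtain ⟨z, rfl⟩ := e.surjective z
      simp [mem_uIoc]
    rw [key, key]
    exact (disjoint_image_iff e.injective).2 this
  · calc ∑ i ∈ Finset.range E.1, dist (e (E.2 i).1) (e (E.2 i).2)
        ≤ ∑ i ∈ Finset.range E.1, K * dist (E.2 i).1 (E.2 i).2 :=
          Finset.sum_le_sum fun i _ => he _ _
      _ = K * ∑ i ∈ Finset.range E.1, dist (E.2 i).1 (E.2 i).2 := by rw [Finset.mul_sum]
      _ ≤ K * (δ / (K + 1)) := by gcongr
      _ < δ := by
        rw [mul_div_assoc', div_lt_iff₀ (by positivity)]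
        nlinarith

theorem AntitoneOn.absolutelyContinuousOnInterval {f : ℝ → ℝ} {a b : ℝ} (hab : a ≤ b)
    (hf : ContinuousOn f (Icc a b)) (hm : AntitoneOn f (Icc a b)) {C : Set ℝ} (hC : C.Countable)
    (hloc : ∀ x ∈ Ioo a b \ C, ∃ c < x, ∃ d > x, AbsolutelyContinuousOnInterval f c d) :
    AbsolutelyContinuousOnInterval f a b := by
  have hint : IntervalIntegrable (deriv f) volume a b := by
    have h : MonotoneOn (fun x => - f x) (uIcc a b) := by
      rw [uIcc_of_le hab]; exact hm.neg
    have h1 := h.intervalIntegrable_deriv.neg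
    have h2 : (-deriv fun x => - f x) = deriv f := by
      ext x; simp
    rwa [h2] at h1
  have hprim : AbsolutelyContinuousOnInterval (fun x => ∫ v in a..x, deriv f v) a b :=
    hint.absolutelyContinuousOnInterval_intervalIntegral (by simp)
  have hpc := hprim.continuousOn
  rw [uIcc_of_le hab] at hpc
  have hconst : ∀ t ∈ Icc a b, f t = f a + ∫ v in a..t, deriv f v := by
    intro t ht
    have h0 := integral_eq_of_hasDerivAt_off_countable_of_le
      (fun x => f x - ∫ v in a..x, deriv f v) (fun _ => 0) ht.1 hC
      ((hf.sub hpc).mono (Icc_subset_Icc_right ht.2)) ?_ (by simp)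
    · simp at h0; linarith
    · rintro x ⟨⟨hx1, hx2⟩, hxC⟩
      obtain ⟨c, hc, d, hd, hac⟩ := hloc x ⟨⟨hx1, hx2.trans_le ht.2⟩, hxC⟩
      have hev : ∀ᶠ y in 𝓝 x, y ∈ Ioo c d ∧ y ∈ Ioo a t :=
        Filter.inter_mem (Ioo_mem_nhds hc hd) (Ioo_mem_nhds hx1 hx2)
      have : (fun y => f y - ∫ v in a..y, deriv f v) =ᶠ[𝓝 x]
          fun _ => f x - ∫ v in a..x, deriv f v := by
        filter_upwards [hev] with y hy
        have h1 : AbsolutelyContinuousOnInterval f x y := by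
          refine hac.mono (uIcc_subset_uIcc ?_ ?_) <;> rw [mem_uIcc] <;> left
          exacts [⟨hc.le, hd.le⟩, ⟨hy.1.1.le, hy.1.2.le⟩]
        have h2 := h1.integral_deriv_eq_sub
        have h3 := intervalIntegral.integral_add_adjacent_intervals
          (hint.mono_set (c := a) (d := x) (uIcc_subset_uIcc (by simp) (by
            rw [mem_uIcc]; left; exact ⟨hx1.le, hx2.le.trans ht.2⟩))) h1.intervalIntegrable_deriv
        linarith
      exact (hasDerivAt_const x _).congr_of_eventuallyEq this
  refine hprim.of_dist_le fun x hx y hy => ?_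
  rw [uIcc_of_le hab] at hx hy
  rw [hconst x hx, hconst y hy, dist_add_left]

/-- A function dominated by an absolutely continuous one has dominated derivative. -/
theorem abs_deriv_le_of_dist_le {f F : ℝ → ℝ} {x F' : ℝ} (hF : HasDerivAt F F' x)
    (h : ∀ᶠ y in 𝓝 x, dist (f y) (f x) ≤ dist (F y) (F x)) : |deriv f x| ≤ |F'| := by
  by_cases hf : DifferentiableAt ℝ f x
  · have h1 := (hasDerivAt_iff_tendsto_slope.1 hf.hasDerivAt).abs
    have h2 := (hasDerivAt_iff_tendsto_slope.1 hF).abs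
    refine le_of_tendsto_of_tendsto h1 h2 ?_
    filter_upwards [h.filter_mono nhdsWithin_le_nhds] with y hy
    simp only [slope_def_field, abs_div]
    rw [Real.dist_eq, Real.dist_eq] at hy
    gcongr
  · rw [deriv_zero_of_not_differentiableAt hf]; simp

/-! ### Local primitives -/

section primitive

variable {f f' : ℝ → ℝ} {c d : ℝ}

theorem intervalIntegrable_of_loc (hint : ∀ a b : ℝ, c < a → b < d → IntegrableOn f' (Icc a b))
    {a b : ℝ} (ha : a ∈ Ioo c d) (hb : b ∈ Ioo c d) : IntervalIntegrable f' volume a b := by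
  rw [intervalIntegrable_iff]
  refine (hint (min a b) (max a b) (lt_min ha.1 hb.1) (max_lt ha.2 hb.2)).mono_set ?_
  exact uIoc_subset_uIcc

theorem absolutelyContinuousOnInterval_of_ftc
    (hint : ∀ a b : ℝ, c < a → b < d → IntegrableOn f' (Icc a b))
    (hftc : ∀ a ∈ Ioo c d, ∀ t ∈ Ioo c d, f t = f a + ∫ s in a..t, f' s)
    {a b : ℝ} (ha : a ∈ Ioo c d) (hb : b ∈ Ioo c d) : AbsolutelyContinuousOnInterval f a b := by
  have h := (intervalIntegrable_of_loc hint ha hb).absolutelyContinuousOnInterval_intervalIntegral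
    (c := a) (by simp)
  refine h.of_dist_le fun x hx y hy => ?_
  have hsub : uIcc a b ⊆ Ioo c d := ordConnected_Ioo.uIcc_subset ha hb
  rw [hftc a ha x (hsub hx), hftc a ha y (hsub hy), dist_add_left]

theorem continuousOn_of_ftc
    (hint : ∀ a b : ℝ, c < a → b < d → IntegrableOn f' (Icc a b))
    (hftc : ∀ a ∈ Ioo c d, ∀ t ∈ Ioo c d, f t = f a + ∫ s in a..t, f' s) :
    ContinuousOn f (Ioo c d) := by
  intro x hx
  obtain ⟨a, ha1, ha2⟩ := exists_between hx.1
  obtain ⟨b, hb1, hb2⟩ := exists_between hx.2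
  have h := (absolutelyContinuousOnInterval_of_ftc hint hftc (a := a) (b := b)
    ⟨ha1, ha2.trans hx.2⟩ ⟨hx.1.trans hb1, hb2⟩).continuousOn
  rw [uIcc_of_le (ha2.trans hb1).le] at h
  exact (h.continuousAt (Icc_mem_nhds ha2 hb1)).continuousWithinAt

theorem hasDerivAt_of_ftc
    (hint : ∀ a b : ℝ, c < a → b < d → IntegrableOn f' (Icc a b))
    (hftc : ∀ a ∈ Ioo c d, ∀ t ∈ Ioo c d, f t = f a + ∫ s in a..t, f' s)
    (hcont : ContinuousOn f' (Ioo c d)) {x : ℝ} (hx : x ∈ Ioo c d) : HasDerivAt f (f' x) x := by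
  have h1 : HasDerivAt (fun y => f x + ∫ s in x..y, f' s) (f' x) x := by
    refine (intervalIntegral.integral_hasDerivAt_right (intervalIntegrable_of_loc hint hx hx)
      ?_ (hcont.continuousAt (isOpen_Ioo.mem_nhds hx))).const_add _
    exact hcont.stronglyMeasurableAtFilter isOpen_Ioo x hx
  refine h1.congr_of_eventuallyEq ?_
  filter_upwards [isOpen_Ioo.mem_nhds hx] with y hy using hftc x hx y hy

theorem ae_hasDerivAt_of_ftc
    (hint : ∀ a b : ℝ, c < a → b < d → IntegrableOn f' (Icc a b))
    (hftc : ∀ a ∈ Ioo c d, ∀ t ∈ Ioo c d, f t = f a + ∫ s in a..t, f' s) :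
    ∀ᵐ x, x ∈ Ioo c d → HasDerivAt f (f' x) x := by
  have key : ∀ q : ℚ × ℚ, ∀ᵐ x, (q.1 : ℝ) ∈ Ioo c d → (q.2 : ℝ) ∈ Ioo c d →
      x ∈ Ioo (q.1 : ℝ) q.2 → HasDerivAt f (f' x) x := by
    rintro ⟨a, b⟩
    by_cases ha : (a : ℝ) ∈ Ioo c d
    swap
    · exact Eventually.of_forall fun x h => absurd h ha
    by_cases hb : (b : ℝ) ∈ Ioo c d
    swap
    · exact Eventually.of_forall fun x _ h => absurd h hb
    filter_upwards [(intervalIntegrable_of_loc hint ha hb).ae_hasDerivAt_integral] with x hx _ _ hxI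
    have hI : x ∈ uIcc (a : ℝ) b := by
      rw [mem_uIcc]; left; exact ⟨hxI.1.le, hxI.2.le⟩
    refine ((hx hI a (by simp)).const_add (f a)).congr_of_eventuallyEq ?_
    filter_upwards [isOpen_Ioo.mem_nhds hxI] with y hy
    exact hftc a ha y ⟨ha.1.trans hy.1, hy.2.trans hb.2⟩
  filter_upwards [ae_all_iff.2 key] with x hx hxI
  obtain ⟨a, ha1, ha2⟩ := exists_rat_btwn hxI.1
  obtain ⟨b, hb1, hb2⟩ := exists_rat_btwn hxI.2
  exact hx (a, b) ⟨ha1, ha2.trans hxI.2⟩ ⟨hxI.1.trans hb1, hb2⟩ ⟨ha2, hb1⟩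

end primitive

/-! ### The upper hull of a planar curve -/

/-- `u` is the upper boundary of the convex hull of the curve `(X, Y)` over `[0,1]`. -/
structure IsUpperHull (X Y : ℝ → ℝ) (u : ℝ → ℝ) : Prop where
  concave : ConcaveOn ℝ (Icc (0:ℝ) 1) u
  cont : ContinuousOn u (Icc (0:ℝ) 1)
  above : ∀ t ∈ Icc (0:ℝ) 1, Y t ≤ u (X t)
  touch_zero : ∃ t ∈ Icc (0:ℝ) 1, X t = 0 ∧ Y t = u 0
  touch_one : ∃ t ∈ Icc (0:ℝ) 1, X t = 1 ∧ Y t = u 1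
  touch_left : ∀ x ∈ Icc (0:ℝ) 1, ∀ m : ℝ, (∀ y ∈ Icc (0:ℝ) 1, u y ≤ u x + m * (y - x)) →
    ∃ t ∈ Icc (0:ℝ) 1, X t ≤ x ∧ Y t = u x + m * (X t - x)
  touch_right : ∀ x ∈ Icc (0:ℝ) 1, ∀ m : ℝ, (∀ y ∈ Icc (0:ℝ) 1, u y ≤ u x + m * (y - x)) →
    ∃ t ∈ Icc (0:ℝ) 1, x ≤ X t ∧ Y t = u x + m * (X t - x)

/-- Lexicographic half-planes are convex. -/
theorem convex_lex (a b c d α β : ℝ) :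
    Convex ℝ {P : ℝ × ℝ | a * P.1 + b * P.2 < α ∨
      (a * P.1 + b * P.2 = α ∧ c * P.1 + d * P.2 < β)} := by
  rintro ⟨p1, p2⟩ hp ⟨q1, q2⟩ hq s t hs ht hst
  simp only [mem_ofPred_eq, Prod.smul_mk, smul_eq_mul, Prod.mk_add_mk] at hp hq ⊢
  rcases hs.eq_or_lt with rfl | hs
  · obtain rfl : t = 1 := by linarith
    simpa using hq
  rcases ht.eq_or_lt with rfl | ht
  · obtain rfl : s = 1 := by linarith
    simpa using hp
  have e1 : a * (s * p1 + t * q1) + b * (s * p2 + t * q2)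
      = s * (a * p1 + b * p2) + t * (a * q1 + b * q2) := by ring
  have e2 : c * (s * p1 + t * q1) + d * (s * p2 + t * q2)
      = s * (c * p1 + d * p2) + t * (c * q1 + d * q2) := by ring
  have e3 : s * α + t * α = α := by rw [← add_mul, hst, one_mul]
  have e4 : s * β + t * β = β := by rw [← add_mul, hst, one_mul]
  rw [e1, e2]
  rcases hp with hp | ⟨hp, hp'⟩ <;> rcases hq with hq | ⟨hq, hq'⟩
  · left; nlinarith [mul_lt_mul_of_pos_left hp hs, mul_lt_mul_of_pos_left hq ht]
  · left; nlinarith [mul_lt_mul_of_pos_left hp hs]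
  · left; nlinarith [mul_lt_mul_of_pos_left hq ht]
  · right
    refine ⟨by rw [hp, hq, e3], ?_⟩
    nlinarith [mul_lt_mul_of_pos_left hp' hs, mul_lt_mul_of_pos_left hq' ht]

theorem concaveOn_Icc_continuousOn {u : ℝ → ℝ} (hu : ConcaveOn ℝ (Icc (0:ℝ) 1) u)
    (husc : ∀ x ∈ Icc (0:ℝ) 1, ∀ c > u x, ∀ᶠ y in 𝓝[Icc 0 1] x, u y < c) :
    ContinuousOn u (Icc (0:ℝ) 1) := by
  intro x hx
  refine tendsto_order.2 ⟨fun c hc => ?_, fun c hc => husc x hx c hc⟩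
  have hI : ContinuousOn u (Ioo 0 1) :=
    (hu.subset Ioo_subset_Icc_self (convex_Ioo 0 1)).continuousOn isOpen_Ioo
  rcases hx.1.eq_or_lt with rfl | h0
  · have hT : Tendsto (fun y : ℝ => (1 - y) * u 0 + y * u 1) (𝓝[Icc 0 1] 0) (𝓝 (u 0)) := by
      have : ContinuousAt (fun y : ℝ => (1 - y) * u 0 + y * u 1) 0 := by fun_prop
      have h := this.tendsto
      simp only [sub_zero, one_mul, zero_mul, add_zero] at h
      exact h.mono_left nhdsWithin_le_nhds
    filter_upwards [hT.eventually (lt_mem_nhds hc), self_mem_nhdsWithin] with y hy hyI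
    have := hu.2 (x := 0) (y := 1) (by simp) (by simp) (sub_nonneg.2 hyI.2) hyI.1 (by ring)
    simp only [smul_eq_mul, mul_zero, mul_one, zero_add] at this
    linarith
  rcases hx.2.eq_or_lt with rfl | h1
  · have hT : Tendsto (fun y : ℝ => (1 - y) * u 0 + y * u 1) (𝓝[Icc 0 1] 1) (𝓝 (u 1)) := by
      have : ContinuousAt (fun y : ℝ => (1 - y) * u 0 + y * u 1) 1 := by fun_prop
      have h := this.tendsto
      simp only [sub_self, one_mul, zero_mul, zero_add] at h
      exact h.mono_left nhdsWithin_le_nhds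
    filter_upwards [hT.eventually (lt_mem_nhds hc), self_mem_nhdsWithin] with y hy hyI
    have := hu.2 (x := 0) (y := 1) (by simp) (by simp) (sub_nonneg.2 hyI.2) hyI.1 (by ring)
    simp only [smul_eq_mul, mul_zero, mul_one, zero_add] at this
    linarith
  · exact ((hI.continuousAt (Ioo_mem_nhds h0 h1)).eventually (lt_mem_nhds hc)).filter_mono
      nhdsWithin_le_nhds

theorem isCompact_convexJoin {s t : Set (ℝ × ℝ)} (hs : IsCompact s) (ht : IsCompact t) :
    IsCompact (convexJoin ℝ s t) := by
  have h : convexJoin ℝ s t = (fun q : ((ℝ × ℝ) × (ℝ × ℝ)) × ℝ =>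
      q.1.1 + q.2 • (q.1.2 - q.1.1)) '' ((s ×ˢ t) ×ˢ Icc (0:ℝ) 1) := by
    ext x
    rw [mem_convexJoin]
    constructor
    · rintro ⟨a, ha, b, hb, hx⟩
      rw [segment_eq_image'] at hx
      obtain ⟨θ, hθ, rfl⟩ := hx
      exact ⟨⟨⟨a, b⟩, θ⟩, ⟨⟨ha, hb⟩, hθ⟩, rfl⟩
    · rintro ⟨⟨⟨a, b⟩, θ⟩, ⟨⟨ha, hb⟩, hθ⟩, rfl⟩
      refine ⟨a, ha, b, hb, ?_⟩
      rw [segment_eq_image']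
      exact ⟨θ, hθ, rfl⟩
  rw [h]
  exact ((hs.prod ht).prod isCompact_Icc).image (by fun_prop)

theorem isCompact_convexHull_prod {S : Set (ℝ × ℝ)} (hS : IsCompact S) :
    IsCompact (convexHull ℝ S) := by
  have h : convexHull ℝ S = convexJoin ℝ S (convexJoin ℝ S S) := by
    refine Subset.antisymm ?_ (convexJoin_subset (subset_convexHull ℝ S)
      (convexJoin_subset (subset_convexHull ℝ S) (subset_convexHull ℝ S)
        (convex_convexHull ℝ S)) (convex_convexHull ℝ S))
    rw [convexHull_eq_union]
    refine iUnion_subset fun F => iUnion_subset fun hF => iUnion_subset fun hai => ?_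
    have hcard : F.card ≤ 3 := by
      have := hai.card_le_finrank_succ
      have h2 := Submodule.finrank_le (vectorSpan ℝ (range ((↑) : F → ℝ × ℝ)))
      simp only [Fintype.card_coe, Module.finrank_prod, Module.finrank_self] at this h2
      omega
    obtain rfl | ⟨a, ha⟩ := F.eq_empty_or_nonempty
    · simp
    obtain ⟨b, c, hbc⟩ : ∃ b c, F = {a, b, c} := by
      have h1 : (F.erase a).card ≤ 2 := by
        rw [Finset.card_erase_of_mem ha]; omega
      rw [← Finset.insert_erase ha]
      obtain h2 | ⟨b, hb⟩ := (F.erase a).eq_empty_or_nonempty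
      · exact ⟨a, a, by simp [h2]⟩
      have h3 : ((F.erase a).erase b).card ≤ 1 := by
        rw [Finset.card_erase_of_mem hb]; omega
      rw [← Finset.insert_erase hb]
      obtain h4 | ⟨c, hc⟩ := ((F.erase a).erase b).eq_empty_or_nonempty
      · exact ⟨b, b, by simp [h4]⟩
      · refine ⟨b, c, ?_⟩
        have h5 : (F.erase a).erase b = {c} :=
          Finset.eq_singleton_iff_unique_mem.2
            ⟨hc, fun z hz => Finset.card_le_one.1 h3 z hz c hc⟩
        rw [h5]
    subst hbc
    push_cast at hF ⊢
    rw [convexHull_insert (by simp), convexHull_pair]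
    refine convexJoin_mono (by simpa using hF (mem_insert _ _)) ?_
    exact segment_subset_convexJoin (hF (by simp)) (hF (by simp))
  rw [h]
  exact isCompact_convexJoin hS (isCompact_convexJoin hS hS)

theorem exists_isUpperHull {X Y : ℝ → ℝ} (hX : ContinuousOn X (Icc (0:ℝ) 1))
    (hY : ContinuousOn Y (Icc (0:ℝ) 1)) (hX0 : X 0 = 0) (hX1 : X 1 = 1) (hY0 : Y 0 = 0)
    (hY1 : Y 1 = 0) (hXI : ∀ t ∈ Icc (0:ℝ) 1, X t ∈ Icc (0:ℝ) 1) :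
    ∃ u, IsUpperHull X Y u := by
  set S : Set (ℝ × ℝ) := (fun t => (X t, Y t)) '' Icc (0:ℝ) 1 with hS
  set H := convexHull ℝ S with hH
  have hSc : IsCompact S := isCompact_Icc.image_of_continuousOn (hX.prodMk hY)
  have hHc : IsCompact H := isCompact_convexHull_prod hSc
  have hmemS : ∀ t ∈ Icc (0:ℝ) 1, (X t, Y t) ∈ H := fun t ht =>
    subset_convexHull ℝ S ⟨t, ht, rfl⟩
  let A : ℝ → Set ℝ := fun x => {y | (x, y) ∈ H}
  have hA : ∀ x, A x = Prod.snd '' (H ∩ Prod.fst ⁻¹' {x}) := by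
    intro x
    ext y
    simp [A]
  have hAc : ∀ x, IsCompact (A x) := by
    intro x
    rw [hA]
    exact (hHc.inter_right (isClosed_singleton.preimage continuous_fst)).image continuous_snd
  have hAne : ∀ x ∈ Icc (0:ℝ) 1, (A x).Nonempty := by
    intro x hx
    refine ⟨0, ?_⟩
    have h0 := hmemS 0 (by simp)
    have h1 := hmemS 1 (by simp)
    rw [hX0, hY0] at h0
    rw [hX1, hY1] at h1
    have := (convex_convexHull ℝ S) h0 h1 (sub_nonneg.2 hx.2) hx.1 (by ring)
    simpa [A] using this
  let u : ℝ → ℝ := fun x => sSup (A x)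
  have hmem : ∀ x ∈ Icc (0:ℝ) 1, (x, u x) ∈ H := fun x hx => (hAc x).sSup_mem (hAne x hx)
  have hle : ∀ x y, (x, y) ∈ H → y ≤ u x := fun x y h => le_csSup (hAc x).bddAbove h
  have habove : ∀ t ∈ Icc (0:ℝ) 1, Y t ≤ u (X t) := fun t ht => hle _ _ (hmemS t ht)
  have hconc : ConcaveOn ℝ (Icc (0:ℝ) 1) u := by
    refine ⟨convex_Icc 0 1, fun x hx y hy a b ha hb hab => hle _ _ ?_⟩
    exact (convex_convexHull ℝ S) (hmem x hx) (hmem y hy) ha hb hab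
  have hsep : ∀ x ∈ Icc (0:ℝ) 1, ∀ a b c d : ℝ,
      (∀ t ∈ Icc (0:ℝ) 1, a * X t + b * Y t ≤ a * x + b * u x) →
      ∃ t ∈ Icc (0:ℝ) 1, a * X t + b * Y t = a * x + b * u x ∧
        c * x + d * u x ≤ c * X t + d * Y t := by
    intro x hx a b c d hall
    by_contra! hcon
    have hsub : H ⊆ _ := convexHull_min (s := S) ?_
      (convex_lex a b c d (a * x + b * u x) (c * x + d * u x))
    · have := hsub (hmem x hx)
      simp at this
    · rintro _ ⟨t, ht, rfl⟩
      rcases (hall t ht).lt_or_eq with h | h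
      · exact Or.inl h
      · exact Or.inr ⟨h, hcon t ht h⟩
  refine ⟨u, hconc, concaveOn_Icc_continuousOn hconc ?_, habove, ?_, ?_, ?_, ?_⟩
  · intro x hx c hc
    have hcl : IsClosed (Prod.fst '' (H ∩ {P : ℝ × ℝ | c ≤ P.2})) :=
      ((hHc.inter_right (isClosed_le continuous_const continuous_snd)).image
        continuous_fst).isClosed
    have hx' : x ∈ (Prod.fst '' (H ∩ {P : ℝ × ℝ | c ≤ P.2}))ᶜ := by
      rintro ⟨⟨p, q⟩, ⟨hP, hq⟩, rfl⟩
      exact absurd (hle p q hP) (not_le.2 (hc.trans_le hq))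
    filter_upwards [mem_nhdsWithin_of_mem_nhds (hcl.isOpen_compl.mem_nhds hx'),
      self_mem_nhdsWithin] with y hy hyI
    by_contra! h
    exact hy ⟨(y, u y), ⟨hmem y hyI, h⟩, rfl⟩
  · obtain ⟨t, ht, h1, h2⟩ := hsep 0 (by simp) (-1) 0 0 1 fun t ht => by
      have := (hXI t ht).1
      linarith
    have h3 : X t = 0 := by linarith
    have h4 := habove t ht
    rw [h3] at h4
    exact ⟨t, ht, h3, by linarith⟩
  · obtain ⟨t, ht, h1, h2⟩ := hsep 1 (by simp) 1 0 0 1 fun t ht => by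
      have := (hXI t ht).2
      linarith
    have h3 : X t = 1 := by linarith
    have h4 := habove t ht
    rw [h3] at h4
    exact ⟨t, ht, h3, by linarith⟩
  · intro x hx m hm
    obtain ⟨t, ht, h1, h2⟩ := hsep x hx (-m) 1 (-1) 0 fun t ht => by
      have := habove t ht
      have := hm _ (hXI t ht)
      linarith
    exact ⟨t, ht, by linarith, by linarith⟩
  · intro x hx m hm
    obtain ⟨t, ht, h1, h2⟩ := hsep x hx (-m) 1 1 0 fun t ht => by
      have := habove t ht
      have := hm _ (hXI t ht)
      linarith
    exact ⟨t, ht, by linarith, by linarith⟩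

theorem ConcaveOn.exists_supergradient {u : ℝ → ℝ} (hu : ConcaveOn ℝ (Icc (0:ℝ) 1) u) {x : ℝ}
    (hx : x ∈ Ioo (0:ℝ) 1) : ∃ m, ∀ y ∈ Icc (0:ℝ) 1, u y ≤ u x + m * (y - x) := by
  have hc : ConvexOn ℝ (Icc (0:ℝ) 1) (-u) := hu.neg
  have hxi : x ∈ interior (Icc (0:ℝ) 1) := by rwa [interior_Icc]
  refine ⟨- derivWithin (-u) (Ioi x) x, fun y hy => ?_⟩
  rcases lt_trichotomy y x with h | rfl | h
  · have h1 := hc.slope_le_leftDeriv_of_mem_interior hy hxi h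
    have h2 := h1.trans (hc.leftDeriv_le_rightDeriv_of_mem_interior hxi)
    rw [slope_def_field, div_le_iff₀ (sub_pos.2 h)] at h2
    simp only [Pi.neg_apply] at h2
    linarith
  · simp
  · have h1 := hc.rightDeriv_le_slope_of_mem_interior hxi hy h
    rw [slope_def_field, le_div_iff₀ (sub_pos.2 h)] at h1
    simp only [Pi.neg_apply] at h1
    linarith

/-! ### Pseudographs -/

theorem Curve1.continuousOn_x (γ : Curve1) : ContinuousOn γ.x (Icc 0 1) := by
  have h := intervalIntegral.continuousOn_primitive_interval (f := γ.dx) (a := 0) (b := 1)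
    (μ := volume) (by rw [uIcc_of_le zero_le_one]; exact γ.dx_int)
  rw [uIcc_of_le zero_le_one] at h
  exact (continuousOn_const.add h).congr γ.ftc_x

theorem Curve1.continuousOn_y (γ : Curve1) : ContinuousOn γ.y (Icc 0 1) := by
  have h := intervalIntegral.continuousOn_primitive_interval (f := γ.dy) (a := 0) (b := 1)
    (μ := volume) (by rw [uIcc_of_le zero_le_one]; exact γ.dy_int)
  rw [uIcc_of_le zero_le_one] at h
  exact (continuousOn_const.add h).congr γ.ftc_y

theorem Curve1.ftc_x_sub (γ : Curve1) {a t : ℝ} (ha : a ∈ Icc (0:ℝ) 1) (ht : t ∈ Icc (0:ℝ) 1) :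
    γ.x t = γ.x a + ∫ s in a..t, γ.dx s := by
  have h : IntervalIntegrable γ.dx volume 0 1 := by
    rw [intervalIntegrable_iff_integrableOn_Icc_of_le zero_le_one]; exact γ.dx_int
  have h1 := intervalIntegral.integral_add_adjacent_intervals
    (h.mono_set (c := 0) (d := a) (uIcc_subset_uIcc (by simp) (by simpa [mem_uIcc] using ha)))
    (h.mono_set (c := a) (d := t) (uIcc_subset_uIcc (by simpa [mem_uIcc] using ha)
      (by simpa [mem_uIcc] using ht)))
  rw [γ.ftc_x t ht, γ.ftc_x a ha, ← h1]; ring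

theorem Curve1.ftc_y_sub (γ : Curve1) {a t : ℝ} (ha : a ∈ Icc (0:ℝ) 1) (ht : t ∈ Icc (0:ℝ) 1) :
    γ.y t = γ.y a + ∫ s in a..t, γ.dy s := by
  have h : IntervalIntegrable γ.dy volume 0 1 := by
    rw [intervalIntegrable_iff_integrableOn_Icc_of_le zero_le_one]; exact γ.dy_int
  have h1 := intervalIntegral.integral_add_adjacent_intervals
    (h.mono_set (c := 0) (d := a) (uIcc_subset_uIcc (by simp) (by simpa [mem_uIcc] using ha)))
    (h.mono_set (c := a) (d := t) (uIcc_subset_uIcc (by simpa [mem_uIcc] using ha)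
      (by simpa [mem_uIcc] using ht)))
  rw [γ.ftc_y t ht, γ.ftc_y a ha, ← h1]; ring

theorem Curve.continuousOn_dx (γ : Curve) : ContinuousOn γ.dx (Ioo 0 1) :=
  continuousOn_of_ftc γ.ddx_loc γ.ftc_dx

theorem Curve.continuousOn_dy (γ : Curve) : ContinuousOn γ.dy (Ioo 0 1) :=
  continuousOn_of_ftc γ.ddy_loc γ.ftc_dy

theorem Curve.hasDerivAt_x (γ : Curve) {t : ℝ} (ht : t ∈ Ioo (0:ℝ) 1) :
    HasDerivAt γ.x (γ.dx t) t :=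
  hasDerivAt_of_ftc (fun _ _ ha hb => γ.dx_int.mono_set (Icc_subset_Icc ha.le hb.le))
    (fun _ ha _ ht => γ.ftc_x_sub (Ioo_subset_Icc_self ha) (Ioo_subset_Icc_self ht))
    γ.continuousOn_dx ht

theorem Curve.hasDerivAt_y (γ : Curve) {t : ℝ} (ht : t ∈ Ioo (0:ℝ) 1) :
    HasDerivAt γ.y (γ.dy t) t :=
  hasDerivAt_of_ftc (fun _ _ ha hb => γ.dy_int.mono_set (Icc_subset_Icc ha.le hb.le))
    (fun _ ha _ ht => γ.ftc_y_sub (Ioo_subset_Icc_self ha) (Ioo_subset_Icc_self ht))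
    γ.continuousOn_dy ht

theorem Pseudograph.monotoneOn_x {γ : Curve} (h : Pseudograph γ) : MonotoneOn γ.x (Icc 0 1) := by
  refine monotoneOn_of_deriv_nonneg (convex_Icc 0 1) γ.continuousOn_x ?_ ?_
  · rw [interior_Icc]
    exact fun t ht => (γ.hasDerivAt_x ht).differentiableAt.differentiableWithinAt
  · rw [interior_Icc]
    intro t ht
    rw [(γ.hasDerivAt_x ht).deriv]
    exact h.2.1 t ht

theorem Pseudograph.sq_add_sq_pos {γ : Curve} (h : Pseudograph γ) {t : ℝ}
    (ht : t ∈ Ioo (0:ℝ) 1) : 0 < γ.dx t ^ 2 + γ.dy t ^ 2 := by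
  obtain ⟨ε, hε, H⟩ := h.1
  exact Real.sqrt_pos.1 (hε.trans (H t ht))

theorem Pseudograph.ne_zero_or {γ : Curve} (h : Pseudograph γ) {t : ℝ}
    (ht : t ∈ Ioo (0:ℝ) 1) (hx : γ.dx t = 0) : γ.dy t ≠ 0 := by
  intro hy
  have := h.sq_add_sq_pos ht
  simp [hx, hy] at this

theorem MemP.x_mem {ψ : ℝ → ℝ} {γ : Curve} (h : MemP ψ γ) {t : ℝ} (ht : t ∈ Icc (0:ℝ) 1) :
    γ.x t ∈ Icc (0:ℝ) 1 := by
  have hm := h.1.monotoneOn_x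
  have h0 := hm (by simp) ht ht.1
  have h1 := hm ht (by simp) ht.2
  rw [h.2.1] at h0
  rw [h.2.2.2.1] at h1
  exact ⟨h0, h1⟩

theorem MemP.mem_Ioo_of_x_mem {ψ : ℝ → ℝ} {γ : Curve} (h : MemP ψ γ) {t : ℝ}
    (ht : t ∈ Icc (0:ℝ) 1) (hx : γ.x t ∈ Ioo (0:ℝ) 1) : t ∈ Ioo (0:ℝ) 1 := by
  refine ⟨ht.1.lt_of_ne ?_, ht.2.lt_of_ne ?_⟩
  · rintro rfl
    rw [h.2.1] at hx
    exact lt_irrefl _ hx.1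
  · rintro rfl
    rw [h.2.2.2.1] at hx
    exact lt_irrefl _ hx.2

/-! ### Regularity of the upper hull -/

theorem hasDerivAt_eq_of_touch {u : ℝ → ℝ} {x q m c : ℝ} (hq : HasDerivAt u q x)
    (h : ∀ᶠ y in 𝓝 x, u y ≤ c + m * (y - x)) (hx : u x = c) : q = m := by
  have h1 : IsLocalMax (fun y => u y - (c + m * (y - x))) x := by
    filter_upwards [h] with y hy
    simp only [sub_self, mul_zero, add_zero]
    linarith
  have h2 : HasDerivAt (fun y => u y - (c + m * (y - x))) (q - m) x := by
    have := hq.sub ((((hasDerivAt_id x).sub_const x).const_mul m).const_add c)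
    exact this.congr_deriv (by simp)
  linarith [h1.hasDerivAt_eq_zero h2]

section hull

variable {ψ : ℝ → ℝ} {γ : Curve} {u : ℝ → ℝ}

/-- The set of abscissae in `(0,1)` at which the curve touches the graph of `u`. -/
def contactSet (γ : Curve) (u : ℝ → ℝ) : Set ℝ :=
  {x | x ∈ Ioo (0:ℝ) 1 ∧ ∃ t ∈ Icc (0:ℝ) 1, γ.x t = x ∧ γ.y t = u x}

theorem IsUpperHull.dy_eq (hγ : MemP ψ γ) (hu : IsUpperHull γ.x γ.y u) {t m : ℝ}
    (ht : t ∈ Ioo (0:ℝ) 1) (hty : γ.y t = u (γ.x t))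
    (hm : ∀ y ∈ Icc (0:ℝ) 1, u y ≤ u (γ.x t) + m * (y - γ.x t)) : γ.dy t = m * γ.dx t := by
  have h1 : IsLocalMax (fun s => γ.y s - m * γ.x s) t := by
    filter_upwards [Icc_mem_nhds ht.1 ht.2] with s hs
    have h2 := hu.above s hs
    have h3 := hm _ (hγ.x_mem hs)
    linarith
  have h2 := h1.hasDerivAt_eq_zero ((γ.hasDerivAt_y ht).sub ((γ.hasDerivAt_x ht).const_mul m))
  linarith

theorem IsUpperHull.dx_pos (hγ : MemP ψ γ) (hu : IsUpperHull γ.x γ.y u) {t : ℝ}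
    (ht : t ∈ Ioo (0:ℝ) 1) (htx : γ.x t ∈ Ioo (0:ℝ) 1) (hty : γ.y t = u (γ.x t)) :
    0 < γ.dx t := by
  obtain ⟨m, hm⟩ := hu.concave.exists_supergradient htx
  have h := hu.dy_eq hγ ht hty hm
  refine (hγ.1.2.1 t ht).lt_of_ne fun h0 => hγ.1.ne_zero_or ht h0.symm ?_
  rw [h, ← h0, mul_zero]

theorem Curve.exists_strictMonoOn (γ : Curve) {t : ℝ} (ht : t ∈ Ioo (0:ℝ) 1)
    (hd : 0 < γ.dx t) : ∃ a b, 0 ≤ a ∧ a < t ∧ t < b ∧ b ≤ 1 ∧ (∀ r ∈ Ioo a b, 0 < γ.dx r) ∧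
      StrictMonoOn γ.x (Icc a b) := by
  have h1 := (γ.continuousOn_dx.continuousAt (isOpen_Ioo.mem_nhds ht)).eventually (lt_mem_nhds hd)
  obtain ⟨a, b, ⟨ha, hb⟩, hsub⟩ := mem_nhds_iff_exists_Ioo_subset.1
    (Filter.inter_mem h1 (isOpen_Ioo.mem_nhds ht))
  have hab := Ioo_subset_Ioo_iff (ha.trans hb) |>.1 (hsub.trans inter_subset_right)
  refine ⟨a, b, hab.1, ha, hb, hab.2, fun r hr => (hsub hr).1, ?_⟩
  refine strictMonoOn_of_deriv_pos (convex_Icc a b)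
    (γ.continuousOn_x.mono (Icc_subset_Icc hab.1 hab.2)) ?_
  rw [interior_Icc]
  intro r hr
  rw [(γ.hasDerivAt_x (hsub hr).2).deriv]
  exact (hsub hr).1

theorem Pseudograph.x_lt_x (h : Pseudograph γ) {s t : ℝ} (hs : s ∈ Icc (0:ℝ) 1)
    (ht : t ∈ Icc (0:ℝ) 1) (hst : s < t)
    (hd : (s ∈ Ioo (0:ℝ) 1 ∧ 0 < γ.dx s) ∨ (t ∈ Ioo (0:ℝ) 1 ∧ 0 < γ.dx t)) : γ.x s < γ.x t := by
  rcases hd with ⟨hs', hd⟩ | ⟨ht', hd⟩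
  · obtain ⟨a, b, ha0, ha, hb, hb1, -, hm⟩ := γ.exists_strictMonoOn hs' hd
    have h1 : s < min t b := lt_min hst hb
    refine (hm ⟨ha.le, hb.le⟩ ⟨(ha.trans h1).le, min_le_right _ _⟩ h1).trans_le ?_
    exact h.monotoneOn_x ⟨hs.1.trans h1.le, (min_le_left _ _).trans ht.2⟩ ht (min_le_left _ _)
  · obtain ⟨a, b, ha0, ha, hb, hb1, -, hm⟩ := γ.exists_strictMonoOn ht' hd
    have h1 : max s a < t := max_lt hst ha
    refine lt_of_le_of_lt ?_ (hm ⟨le_max_right _ _, (h1.trans hb).le⟩ ⟨ha.le, hb.le⟩ h1)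
    exact h.monotoneOn_x hs ⟨hs.1.trans (le_max_left _ _), h1.le.trans ht.2⟩ (le_max_left _ _)

theorem Pseudograph.eq_of_x_eq (h : Pseudograph γ) {s t : ℝ} (hs : s ∈ Icc (0:ℝ) 1)
    (ht : t ∈ Ioo (0:ℝ) 1) (hd : 0 < γ.dx t) (hst : γ.x s = γ.x t) : s = t := by
  rcases lt_trichotomy s t with h1 | h1 | h1
  · exact absurd hst (h.x_lt_x hs (Ioo_subset_Icc_self ht) h1 (Or.inr ⟨ht, hd⟩)).ne
  · exact h1
  · exact absurd hst (h.x_lt_x (Ioo_subset_Icc_self ht) hs h1 (Or.inl ⟨ht, hd⟩)).ne'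

/-- `U` is a local graph representation of the curve over `(c,d)`. -/
structure LocalGraph (γ : Curve) (u U dU ddU : ℝ → ℝ) (c d : ℝ) : Prop where
  zero_le : 0 ≤ c
  le_one : d ≤ 1
  reg : W22locOn U dU ddU c d
  le : ∀ x ∈ Ioo c d, U x ≤ u x
  eq : ∀ x ∈ Ioo c d, x ∈ contactSet γ u → U x = u x

theorem LocalGraph.hasDerivAt {U dU ddU : ℝ → ℝ} {c d x : ℝ} (h : LocalGraph γ u U dU ddU c d)
    (hx : x ∈ Ioo c d) : HasDerivAt U (dU x) x :=
  hasDerivAt_of_ftc h.reg.du_loc h.reg.ftc_u (continuousOn_of_ftc h.reg.ddu_loc h.reg.ftc_du) hx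

theorem IsUpperHull.exists_localGraph (hγ : MemP ψ γ) (hu : IsUpperHull γ.x γ.y u) {x : ℝ}
    (hx : x ∈ contactSet γ u) :
    ∃ U dU ddU c d, x ∈ Ioo c d ∧ LocalGraph γ u U dU ddU c d := by
  obtain ⟨hx, t, ht, rfl, hty⟩ := hx
  have ht' := hγ.mem_Ioo_of_x_mem ht hx
  have hd := hu.dx_pos hγ ht' hx hty
  obtain ⟨a, b, ha0, ha, hb, hb1, hpos, hm⟩ := γ.exists_strictMonoOn ht' hd
  obtain ⟨U, dU, ddU, hreg, hU⟩ := hγ.1.2.2 a b ha0 (ha.trans hb) hb1 hpos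
  have haI : a ∈ Icc a b := ⟨le_rfl, (ha.trans hb).le⟩
  have hbI : b ∈ Icc a b := ⟨(ha.trans hb).le, le_rfl⟩
  have htI : t ∈ Icc a b := ⟨ha.le, hb.le⟩
  have hsub : Icc a b ⊆ Icc 0 1 := Icc_subset_Icc ha0 hb1
  have hr : ∀ x ∈ Ioo (γ.x a) (γ.x b), ∃ r ∈ Ioo a b, γ.x r = x := fun x hx =>
    intermediate_value_Ioo (ha.trans hb).le (γ.continuousOn_x.mono hsub) hx
  refine ⟨U, dU, ddU, γ.x a, γ.x b, ⟨hm haI htI ha, hm htI hbI hb⟩,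
    (hγ.x_mem (hsub haI)).1, (hγ.x_mem (hsub hbI)).2, hreg, ?_, ?_⟩
  · intro x hx
    obtain ⟨r, hr, rfl⟩ := hr x hx
    rw [hU r hr]
    exact hu.above r (hsub (Ioo_subset_Icc_self hr))
  · rintro x hx ⟨hx', s, hs, rfl, hsy⟩
    obtain ⟨r, hr, hrx⟩ := hr _ hx
    have hr' : r ∈ Ioo (0:ℝ) 1 := ⟨ha0.trans_lt hr.1, hr.2.trans_le hb1⟩
    obtain rfl := hγ.1.eq_of_x_eq hs hr' (hpos r hr) hrx.symm
    rw [hU s hr, hsy]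

theorem LocalGraph.hasDerivAt_hull (hu : IsUpperHull γ.x γ.y u) {U dU ddU : ℝ → ℝ} {c d x : ℝ}
    (h : LocalGraph γ u U dU ddU c d) (hx : x ∈ Ioo c d) (hxK : x ∈ contactSet γ u) :
    HasDerivAt u (dU x) x := by
  obtain ⟨m, hm⟩ := hu.concave.exists_supergradient hxK.1
  have hUx := h.eq x hx hxK
  have hev : ∀ᶠ y in 𝓝 x, U y ≤ u y ∧ u y ≤ u x + m * (y - x) := by
    filter_upwards [isOpen_Ioo.mem_nhds hx] with y hy
    exact ⟨h.le y hy, hm y ⟨h.zero_le.trans hy.1.le, hy.2.le.trans h.le_one⟩⟩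
  have hUd := h.hasDerivAt hx
  have hdm : dU x = m := hasDerivAt_eq_of_touch hUd (hev.mono fun y hy => hy.1.trans hy.2) hUx
  rw [hasDerivAt_iff_isLittleO] at hUd ⊢
  refine (Asymptotics.IsBigO.of_bound 1 ?_).trans_isLittleO hUd
  filter_upwards [hev] with y hy
  rw [hdm, hUx, smul_eq_mul, one_mul, Real.norm_eq_abs, Real.norm_eq_abs, abs_of_nonpos,
    abs_of_nonpos] <;> linarith [hy.1, hy.2]

/-- Off the contact set the upper hull is affine up to the next contact points. -/
theorem IsUpperHull.exists_affine (hγ : MemP ψ γ) (hu : IsUpperHull γ.x γ.y u) {x : ℝ}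
    (hx : x ∈ Ioo (0:ℝ) 1) (hxK : x ∉ contactSet γ u) :
    ∃ z₁ z₂ m, z₁ < x ∧ x < z₂ ∧ (z₁ = 0 ∨ z₁ ∈ contactSet γ u) ∧
      (z₂ = 1 ∨ z₂ ∈ contactSet γ u) ∧
      ∀ y ∈ Icc z₁ z₂, y ∈ Ioo (0:ℝ) 1 → HasDerivAt u m y := by
  obtain ⟨m, hm⟩ := hu.concave.exists_supergradient hx
  have hxI := Ioo_subset_Icc_self hx
  obtain ⟨t₁, ht₁, hz₁, hy₁⟩ := hu.touch_left x hxI m hm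
  obtain ⟨t₂, ht₂, hz₂, hy₂⟩ := hu.touch_right x hxI m hm
  have key : ∀ t ∈ Icc (0:ℝ) 1, γ.y t = u x + m * (γ.x t - x) →
      γ.y t = u (γ.x t) ∧ γ.x t ≠ x := by
    intro t ht hy
    have h1 : γ.y t = u (γ.x t) := by
      have := hu.above t ht
      have := hm _ (hγ.x_mem ht)
      linarith
    refine ⟨h1, ?_⟩
    rintro rfl
    exact hxK ⟨hx, t, ht, rfl, h1⟩
  obtain ⟨hu₁, hne₁⟩ := key t₁ ht₁ hy₁
  obtain ⟨hu₂, hne₂⟩ := key t₂ ht₂ hy₂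
  have hI₁ := hγ.x_mem ht₁
  have hI₂ := hγ.x_mem ht₂
  have h1 : γ.x t₁ < x := hz₁.lt_of_ne hne₁
  have h2 : x < γ.x t₂ := hz₂.lt_of_ne hne₂.symm
  set z₁ := γ.x t₁ with hz₁'
  set z₂ := γ.x t₂ with hz₂'
  have hK₁ : 0 < z₁ → z₁ ∈ contactSet γ u := fun h => ⟨⟨h, h1.trans hx.2⟩, t₁, ht₁, rfl, hu₁⟩
  have hK₂ : z₂ < 1 → z₂ ∈ contactSet γ u := fun h => ⟨⟨hx.1.trans h2, h⟩, t₂, ht₂, rfl, hu₂⟩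
  have haff : ∀ y ∈ Icc z₁ z₂, u y = u x + m * (y - x) := by
    intro y hy
    have hzz : 0 < z₂ - z₁ := by linarith
    refine le_antisymm (hm y ⟨hI₁.1.trans hy.1, hy.2.trans hI₂.2⟩) ?_
    have ha : 0 ≤ (z₂ - y) / (z₂ - z₁) := div_nonneg (by linarith [hy.2]) hzz.le
    have hb : 0 ≤ (y - z₁) / (z₂ - z₁) := div_nonneg (by linarith [hy.1]) hzz.le
    have h3 := hu.concave.2 hI₁ hI₂ ha hb
      (by field_simp; ring)
    simp only [smul_eq_mul] at h3
    rw [← hu₁, ← hu₂, hy₁, hy₂] at h3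
    convert h3 using 1
    · field_simp; ring
    · congr 1; field_simp; ring
  refine ⟨z₁, z₂, m, h1, h2, ?_, ?_, ?_⟩
  · rcases hI₁.1.eq_or_lt with h | h
    exacts [Or.inl h.symm, Or.inr (hK₁ h)]
  · rcases hI₂.2.eq_or_lt with h | h
    exacts [Or.inl h, Or.inr (hK₂ h)]
  · intro y hy hy01
    have hline : HasDerivAt (fun y => u x + m * (y - x)) m y := by
      simpa using (((hasDerivAt_id y).sub_const x).const_mul m).const_add (u x)
    by_cases hyI : y ∈ Ioo z₁ z₂
    · refine hline.congr_of_eventuallyEq ?_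
      filter_upwards [isOpen_Ioo.mem_nhds hyI] with w hw using haff w (Ioo_subset_Icc_self hw)
    · have hyK : y ∈ contactSet γ u := by
        rcases hy.1.eq_or_lt with rfl | h3
        · exact hK₁ hy01.1
        rcases hy.2.eq_or_lt with rfl | h4
        · exact hK₂ hy01.2
        exact absurd ⟨h3, h4⟩ hyI
      obtain ⟨U, dU, ddU, c, d, hyc, hg⟩ := hu.exists_localGraph hγ hyK
      have h3 := hg.hasDerivAt_hull hu hyc hyK
      have h4 : dU y = m := by
        refine hasDerivAt_eq_of_touch (c := u y) h3 ?_ rfl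
        filter_upwards [Icc_mem_nhds hy01.1 hy01.2] with w hw
        have := hm w hw
        rw [haff y hy]
        linarith
      rwa [h4] at h3

theorem IsUpperHull.differentiableAt (hγ : MemP ψ γ) (hu : IsUpperHull γ.x γ.y u) {x : ℝ}
    (hx : x ∈ Ioo (0:ℝ) 1) : DifferentiableAt ℝ u x := by
  by_cases hxK : x ∈ contactSet γ u
  · obtain ⟨U, dU, ddU, c, d, hxc, hg⟩ := hu.exists_localGraph hγ hxK
    exact (hg.hasDerivAt_hull hu hxc hxK).differentiableAt
  · obtain ⟨z₁, z₂, m, h1, h2, -, -, h⟩ := hu.exists_affine hγ hx hxK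
    exact (h x ⟨h1.le, h2.le⟩ hx).differentiableAt

theorem IsUpperHull.le_tangent (hγ : MemP ψ γ) (hu : IsUpperHull γ.x γ.y u) {x y : ℝ}
    (hx : x ∈ Ioo (0:ℝ) 1) (hy : y ∈ Icc (0:ℝ) 1) : u y ≤ u x + deriv u x * (y - x) := by
  obtain ⟨m, hm⟩ := hu.concave.exists_supergradient hx
  rw [hasDerivAt_eq_of_touch (hu.differentiableAt hγ hx).hasDerivAt
    (by filter_upwards [Icc_mem_nhds hx.1 hx.2] with w hw using hm w hw) rfl]
  exact hm y hy

theorem IsUpperHull.antitoneOn_deriv (hγ : MemP ψ γ) (hu : IsUpperHull γ.x γ.y u) :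
    AntitoneOn (deriv u) (Ioo (0:ℝ) 1) := by
  intro x hx y hy hxy
  rcases hxy.eq_or_lt with rfl | h
  · exact le_rfl
  have h1 := hu.le_tangent hγ hx (Ioo_subset_Icc_self hy)
  have h2 := hu.le_tangent hγ hy (Ioo_subset_Icc_self hx)
  nlinarith

theorem IsUpperHull.isCompact_contactSet_inter (hγ : MemP ψ γ) (hu : IsUpperHull γ.x γ.y u)
    {a b : ℝ} (ha : 0 < a) (hb : b < 1) : IsCompact (contactSet γ u ∩ Icc a b) := by
  have h1 : ContinuousOn (fun t => (γ.x t, γ.y t - u (γ.x t))) (Icc 0 1) :=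
    γ.continuousOn_x.prodMk (γ.continuousOn_y.sub
      (hu.cont.comp γ.continuousOn_x fun t ht => hγ.x_mem ht))
  have h2 := h1.preimage_isClosed_of_isClosed isClosed_Icc
    (t := Icc a b ×ˢ {0}) (isClosed_Icc.prod isClosed_singleton)
  have h3 := (isCompact_Icc.of_isClosed_subset h2 inter_subset_left).image_of_continuousOn
    (γ.continuousOn_x.mono inter_subset_left)
  convert h3 using 1
  ext x
  constructor
  · rintro ⟨⟨hx, t, ht, rfl, hty⟩, hxI⟩
    exact ⟨t, ⟨ht, hxI, by simp [hty]⟩, rfl⟩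
  · rintro ⟨t, ⟨ht, hxI, hty⟩, rfl⟩
    simp only [mem_singleton_iff] at hty
    exact ⟨⟨⟨ha.trans_le hxI.1, hxI.2.trans_lt hb⟩, t, ht, rfl, by linarith⟩, hxI⟩

theorem LocalGraph.dist_deriv_le (hγ : MemP ψ γ) (hu : IsUpperHull γ.x γ.y u)
    {U dU ddU : ℝ → ℝ} {c d : ℝ} (h : LocalGraph γ u U dU ddU c d) {x y : ℝ}
    (hx : x ∈ Ioo c d) (hy : y ∈ Ioo c d) (hxy : x ≤ y) :
    |deriv u x - deriv u y| ≤ ∫ s in x..y, |ddU s| := by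
  have h01 : ∀ z ∈ Icc x y, z ∈ Ioo (0:ℝ) 1 := fun z hz =>
    ⟨h.zero_le.trans_lt (hx.1.trans_le hz.1), hz.2.trans_lt (hy.2.trans_le h.le_one)⟩
  have hcd : ∀ z ∈ Icc x y, z ∈ Ioo c d := fun z hz => ⟨hx.1.trans_le hz.1, hz.2.trans_lt hy.2⟩
  have hx01 := h01 x ⟨le_rfl, hxy⟩
  have hy01 := h01 y ⟨hxy, le_rfl⟩
  have hint := (intervalIntegrable_of_loc h.reg.ddu_loc hx hy).abs
  have hc := hu.isCompact_contactSet_inter hγ hx01.1 hy01.2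
  obtain hemp | hne := (contactSet γ u ∩ Icc x y).eq_empty_or_nonempty
  · have hxK : x ∉ contactSet γ u := fun hK => by
      have : x ∈ contactSet γ u ∩ Icc x y := ⟨hK, le_rfl, hxy⟩
      simp [hemp] at this
    obtain ⟨z₁, z₂, m, h1, h2, -, h4, h5⟩ := hu.exists_affine hγ hx01 hxK
    have hyz : y ≤ z₂ := by
      rcases h4 with rfl | h4
      · exact hy01.2.le
      by_contra! hlt
      have : z₂ ∈ contactSet γ u ∩ Icc x y := ⟨h4, h2.le, hlt.le⟩
      simp [hemp] at this
    rw [(h5 x ⟨h1.le, h2.le⟩ hx01).deriv, (h5 y ⟨h1.le.trans hxy, hyz⟩ hy01).deriv]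
    simpa using intervalIntegral.integral_nonneg hxy fun s _ => abs_nonneg (ddU s)
  · obtain ⟨x', ⟨hx'K, hx'⟩, hmin⟩ := hc.exists_isLeast hne
    obtain ⟨y', ⟨hy'K, hy'⟩, hmax⟩ := hc.exists_isGreatest hne
    have hxy' : x' ≤ y' := hmin ⟨hy'K, hy'⟩
    have e1 : deriv u x = deriv u x' := by
      by_cases hxK : x ∈ contactSet γ u
      · rw [le_antisymm hx'.1 (hmin ⟨hxK, le_rfl, hxy⟩)]
      obtain ⟨z₁, z₂, m, h1, h2, -, h4, h5⟩ := hu.exists_affine hγ hx01 hxK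
      have hz : x' ≤ z₂ := by
        rcases h4 with rfl | h4
        · exact hx'K.1.2.le
        by_contra! hlt
        exact absurd (hmin ⟨h4, h2.le, (hlt.trans_le hx'.2).le⟩) (not_le.2 hlt)
      rw [(h5 x ⟨h1.le, h2.le⟩ hx01).deriv, (h5 x' ⟨h1.le.trans hx'.1, hz⟩ hx'K.1).deriv]
    have e2 : deriv u y = deriv u y' := by
      by_cases hyK : y ∈ contactSet γ u
      · rw [le_antisymm (hmax ⟨hyK, hxy, le_rfl⟩) hy'.2]
      obtain ⟨z₁, z₂, m, h1, h2, h4, -, h5⟩ := hu.exists_affine hγ hy01 hyK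
      have hz : z₁ ≤ y' := by
        rcases h4 with rfl | h4
        · exact hy'K.1.1.le
        by_contra! hlt
        exact absurd (hmax ⟨h4, (hy'.1.trans_lt hlt).le, h1.le⟩) (not_le.2 hlt)
      rw [(h5 y ⟨h1.le, h2.le⟩ hy01).deriv, (h5 y' ⟨hz, hy'.2.trans h2.le⟩ hy'K.1).deriv]
    rw [e1, e2, (h.hasDerivAt_hull hu (hcd _ hx') hx'K).deriv,
      (h.hasDerivAt_hull hu (hcd _ hy') hy'K).deriv,
      h.reg.ftc_du x' (hcd _ hx') y' (hcd _ hy'), sub_add_cancel_left, abs_neg]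
    refine (intervalIntegral.abs_integral_le_integral_abs hxy').trans ?_
    refine intervalIntegral.integral_mono_interval hx'.1 hxy' hy'.2
      (Eventually.of_forall fun s => abs_nonneg _) hint

end hull

section hull

variable {ψ : ℝ → ℝ} {γ : Curve} {u : ℝ → ℝ}

theorem IsUpperHull.deriv_eventually_const (hγ : MemP ψ γ) (hu : IsUpperHull γ.x γ.y u) {x : ℝ}
    (hx : x ∈ Ioo (0:ℝ) 1) (hxK : x ∉ contactSet γ u) :
    ∃ c < x, ∃ d > x, 0 < c ∧ d < 1 ∧ ∀ y ∈ Icc c d, deriv u y = deriv u x := by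
  obtain ⟨z₁, z₂, m, h1, h2, -, -, h⟩ := hu.exists_affine hγ hx hxK
  obtain ⟨c, hc, hcx⟩ := exists_between (max_lt h1 hx.1)
  obtain ⟨d, hxd, hd⟩ := exists_between (lt_min h2 hx.2)
  rw [max_lt_iff] at hc
  rw [lt_min_iff] at hd
  refine ⟨c, hcx, d, hxd, hc.2, hd.2, fun y hy => ?_⟩
  rw [(h y ⟨hc.1.le.trans hy.1, hy.2.trans hd.1.le⟩
    ⟨hc.2.trans_le hy.1, hy.2.trans_lt hd.2⟩).deriv, (h x ⟨h1.le, h2.le⟩ hx).deriv]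

theorem IsUpperHull.exists_deriv_absolutelyContinuous (hγ : MemP ψ γ)
    (hu : IsUpperHull γ.x γ.y u) {x : ℝ} (hx : x ∈ Ioo (0:ℝ) 1) :
    ∃ c < x, ∃ d > x, AbsolutelyContinuousOnInterval (deriv u) c d ∧
      IntegrableOn (fun y => deriv (deriv u) y ^ 2) (Icc c d) := by
  by_cases hxK : x ∈ contactSet γ u
  · obtain ⟨U, dU, ddU, c', d', hxc, hg⟩ := hu.exists_localGraph hγ hxK
    obtain ⟨c, hc', hc⟩ := exists_between hxc.1
    obtain ⟨d, hd, hd'⟩ := exists_between hxc.2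
    have hcd := (hc.trans hd).le
    have hcI : c ∈ Ioo c' d' := ⟨hc', hc.trans hxc.2⟩
    have hdI : d ∈ Ioo c' d' := ⟨hxc.1.trans hd, hd'⟩
    have hint := (intervalIntegrable_of_loc hg.reg.ddu_loc hcI hdI).abs
    have hsub : ∀ y ∈ Icc c d, y ∈ Ioo c' d' := fun y hy =>
      ⟨hc'.trans_le hy.1, hy.2.trans_lt hd'⟩
    have hmem : ∀ y ∈ Icc c d, y ∈ uIcc c d := fun y hy => by rwa [uIcc_of_le hcd]
    have hsubI : ∀ y ∈ Icc c d, IntervalIntegrable (fun s => |ddU s|) volume c y := fun y hy =>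
      hint.mono_set (uIcc_subset_uIcc (by simp) (hmem y hy))
    have hle : ∀ y ∈ Icc c d, ∀ z ∈ Icc c d, y ≤ z → dist (deriv u y) (deriv u z) ≤
        dist (∫ s in c..y, |ddU s|) (∫ s in c..z, |ddU s|) := by
      intro y hy z hz hyz
      have h1 := hg.dist_deriv_le hγ hu (hsub y hy) (hsub z hz) hyz
      rw [← intervalIntegral.integral_interval_sub_left (hsubI z hz) (hsubI y hy)] at h1
      rw [Real.dist_eq, Real.dist_eq, abs_sub_comm (∫ s in c..y, |ddU s|)]
      exact h1.trans (le_abs_self _)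
    have hle' : ∀ y ∈ Icc c d, ∀ z ∈ Icc c d, dist (deriv u y) (deriv u z) ≤
        dist (∫ s in c..y, |ddU s|) (∫ s in c..z, |ddU s|) := by
      intro y hy z hz
      rcases le_total y z with h | h
      · exact hle y hy z hz h
      · rw [dist_comm, dist_comm (∫ s in c..y, |ddU s|)]
        exact hle z hz y hy h
    refine ⟨c, hc, d, hd, ?_, ?_⟩
    · refine (hint.absolutelyContinuousOnInterval_intervalIntegral (c := c) (by simp)).of_dist_le ?_
      rwa [uIcc_of_le hcd]
    · refine Integrable.mono' (hg.reg.ddu_sq c d hc' hd')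
        ((measurable_deriv _).pow_const 2).aestronglyMeasurable ?_
      have h1 : ∀ᵐ y, y ∈ Ioo c d → ‖deriv (deriv u) y ^ 2‖ ≤ ddU y ^ 2 := by
        filter_upwards [hint.ae_hasDerivAt_integral] with y hy hyI
        have hyI' := Ioo_subset_Icc_self hyI
        have h2 := abs_deriv_le_of_dist_le (f := deriv u) (hy (hmem y hyI') c (by simp)) (by
          filter_upwards [Icc_mem_nhds hyI.1 hyI.2] with w hw using hle' w hw y hyI')
        rw [abs_abs] at h2
        rw [Real.norm_eq_abs, abs_pow, ← sq_abs (ddU y)]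
        gcongr
      rw [← restrict_Ioo_eq_restrict_Icc]
      exact (ae_restrict_iff' measurableSet_Ioo).2 h1
  · obtain ⟨c, hc, d, hd, -, -, h⟩ := hu.deriv_eventually_const hγ hx hxK
    refine ⟨c, hc, d, hd, ?_, ?_⟩
    · refine ((LipschitzWith.id (α := ℝ)).lipschitzOnWith
        (s := uIcc c d)).absolutelyContinuousOnInterval.of_dist_le fun y hy z hz => ?_
      rw [uIcc_of_le (hc.trans hd).le] at hy hz
      rw [h y hy, h z hz, dist_self]
      exact dist_nonneg
    · rw [integrableOn_Icc_iff_integrableOn_Ioo]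
      refine (integrableOn_zero (ε' := ℝ)).congr_fun ?_ measurableSet_Ioo
      intro y hy
      have : deriv u =ᶠ[𝓝 y] fun _ => deriv u x := by
        filter_upwards [Icc_mem_nhds hy.1 hy.2] with w hw using h w hw
      simp [this.deriv_eq]

theorem IsUpperHull.continuousOn_deriv (hγ : MemP ψ γ) (hu : IsUpperHull γ.x γ.y u) :
    ContinuousOn (deriv u) (Ioo (0:ℝ) 1) := by
  intro x hx
  obtain ⟨c, hc, d, hd, hac, -⟩ := hu.exists_deriv_absolutelyContinuous hγ hx
  have := hac.continuousOn
  rw [uIcc_of_le (hc.trans hd).le] at this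
  exact (this.continuousAt (Icc_mem_nhds hc hd)).continuousWithinAt

theorem IsUpperHull.w22locOn (hγ : MemP ψ γ) (hu : IsUpperHull γ.x γ.y u) :
    W22locOn u (deriv u) (deriv (deriv u)) 0 1 := by
  have hac : ∀ a b : ℝ, 0 < a → a ≤ b → b < 1 →
      AbsolutelyContinuousOnInterval (deriv u) a b := by
    intro a b ha hab hb
    have hsub : Icc a b ⊆ Ioo 0 1 := fun x hx => ⟨ha.trans_le hx.1, hx.2.trans_lt hb⟩
    refine AntitoneOn.absolutelyContinuousOnInterval hab ((hu.continuousOn_deriv hγ).mono hsub)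
      ((hu.antitoneOn_deriv hγ).mono hsub) countable_empty fun x hx => ?_
    obtain ⟨c, hc, d, hd, hac, -⟩ :=
      hu.exists_deriv_absolutelyContinuous hγ (hsub (Ioo_subset_Icc_self hx.1))
    exact ⟨c, hc, d, hd, hac⟩
  have hac' : ∀ a ∈ Ioo (0:ℝ) 1, ∀ b ∈ Ioo (0:ℝ) 1,
      AbsolutelyContinuousOnInterval (deriv u) a b := by
    intro a ha b hb
    rcases le_total a b with h | h
    · exact hac a b ha.1 h hb.2
    · exact (hac b a hb.1 h ha.2).symm
  refine ⟨fun a b ha hb => ?_, fun a b ha hb => ?_, fun a b ha hb => ?_, fun a ha t ht => ?_,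
    fun a ha t ht => ?_⟩
  · refine ContinuousOn.integrableOn_Icc ((hu.continuousOn_deriv hγ).mono ?_)
    exact fun x hx => ⟨ha.trans_le hx.1, hx.2.trans_lt hb⟩
  · rcases le_or_gt a b with h | h
    · exact (intervalIntegrable_iff_integrableOn_Icc_of_le h).1
        (hac a b ha h hb).intervalIntegrable_deriv
    · rw [Icc_eq_empty (not_le.2 h)]; exact integrableOn_empty
  · have hl : LocallyIntegrableOn (fun y => deriv (deriv u) y ^ 2) (Icc a b) := by
      intro x hx
      obtain ⟨c, hc, d, hd, -, hi⟩ := hu.exists_deriv_absolutelyContinuous hγ (x := x)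
        ⟨ha.trans_le hx.1, hx.2.trans_lt hb⟩
      exact ⟨Icc c d, mem_nhdsWithin_of_mem_nhds (Icc_mem_nhds hc hd), hi⟩
    exact hl.integrableOn_isCompact isCompact_Icc
  · have hsub : uIcc a t ⊆ Ioo 0 1 := ordConnected_Ioo.uIcc_subset ha ht
    rw [intervalIntegral.integral_eq_sub_of_hasDerivAt
      (fun x hx => (hu.differentiableAt hγ (hsub hx)).hasDerivAt)
      ((hu.continuousOn_deriv hγ).mono hsub).intervalIntegrable]
    ring
  · rw [(hac' a ha t ht).integral_deriv_eq_sub]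
    ring

theorem IsUpperHull.exists_lt_deriv (hγ : MemP ψ γ) (hu : IsUpperHull γ.x γ.y u)
    (h0 : 0 < u 0) (M : ℝ) : ∃ x ∈ Ioo (0:ℝ) 1, M < deriv u x := by
  by_contra! hM
  have hle : ∀ y ∈ Icc (0:ℝ) 1, u y ≤ u 0 + M * y := by
    intro y hy
    rcases hy.1.eq_or_lt with rfl | hy0
    · simp
    have hT : Tendsto (fun x => u x + M * (y - x)) (𝓝[>] 0) (𝓝 (u 0 + M * (y - 0))) := by
      have h1 : ContinuousWithinAt (fun x => u x + M * (y - x)) (Icc 0 1) 0 :=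
        (hu.cont 0 (by simp)).add (by fun_prop)
      refine h1.tendsto.mono_left ?_
      rw [← nhdsWithin_Ioo_eq_nhdsGT (zero_lt_one (α := ℝ))]
      exact nhdsWithin_mono _ Ioo_subset_Icc_self
    rw [sub_zero] at hT
    refine ge_of_tendsto hT ?_
    filter_upwards [Ioo_mem_nhdsGT hy0] with x hx
    have hx01 : x ∈ Ioo (0:ℝ) 1 := ⟨hx.1, hx.2.trans_le hy.2⟩
    have h1 := hu.le_tangent hγ hx01 hy
    nlinarith [hM x hx01, hx.2]
  obtain ⟨t, ht, htx, hty⟩ := hu.touch_zero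
  have ht' : t ∈ Ioo (0:ℝ) 1 := by
    refine ⟨ht.1.lt_of_ne ?_, ht.2.lt_of_ne ?_⟩
    · rintro rfl
      rw [hγ.2.2.1] at hty
      exact h0.ne hty
    · rintro rfl
      rw [hγ.2.2.2.2.1] at hty
      exact h0.ne hty
  have hmin : IsLocalMin γ.x t := by
    filter_upwards [Icc_mem_nhds ht'.1 ht'.2] with s hs
    rw [htx]
    exact (hγ.x_mem hs).1
  have hdx := hmin.hasDerivAt_eq_zero (γ.hasDerivAt_x ht')
  refine hγ.1.ne_zero_or ht' hdx ?_
  rw [hu.dy_eq hγ (m := M) ht' (by rw [htx, hty]) ?_, hdx, mul_zero]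
  intro y hy
  rw [htx, sub_zero]
  exact hle y hy

theorem IsUpperHull.exists_deriv_lt (hγ : MemP ψ γ) (hu : IsUpperHull γ.x γ.y u)
    (h1 : 0 < u 1) (M : ℝ) : ∃ x ∈ Ioo (0:ℝ) 1, deriv u x < M := by
  by_contra! hM
  have hle : ∀ y ∈ Icc (0:ℝ) 1, u y ≤ u 1 + M * (y - 1) := by
    intro y hy
    rcases hy.2.eq_or_lt with rfl | hy1
    · simp
    have hT : Tendsto (fun x => u x + M * (y - x)) (𝓝[<] 1) (𝓝 (u 1 + M * (y - 1))) := by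
      have h1 : ContinuousWithinAt (fun x => u x + M * (y - x)) (Icc 0 1) 1 :=
        (hu.cont 1 (by simp)).add (by fun_prop)
      refine h1.tendsto.mono_left ?_
      rw [← nhdsWithin_Ioo_eq_nhdsLT (zero_lt_one (α := ℝ))]
      exact nhdsWithin_mono _ Ioo_subset_Icc_self
    refine ge_of_tendsto hT ?_
    filter_upwards [Ioo_mem_nhdsLT hy1] with x hx
    have hx01 : x ∈ Ioo (0:ℝ) 1 := ⟨hy.1.trans_lt hx.1, hx.2⟩
    have h1 := hu.le_tangent hγ hx01 hy
    nlinarith [hM x hx01, hx.1]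
  obtain ⟨t, ht, htx, hty⟩ := hu.touch_one
  have ht' : t ∈ Ioo (0:ℝ) 1 := by
    refine ⟨ht.1.lt_of_ne ?_, ht.2.lt_of_ne ?_⟩
    · rintro rfl
      rw [hγ.2.2.1] at hty
      exact h1.ne hty
    · rintro rfl
      rw [hγ.2.2.2.2.1] at hty
      exact h1.ne hty
  have hmax : IsLocalMax γ.x t := by
    filter_upwards [Icc_mem_nhds ht'.1 ht'.2] with s hs
    rw [htx]
    exact (hγ.x_mem hs).2
  have hdx := hmax.hasDerivAt_eq_zero (γ.hasDerivAt_x ht')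
  refine hγ.1.ne_zero_or ht' hdx ?_
  rw [hu.dy_eq hγ (m := M) ht' (by rw [htx, hty]) ?_, hdx, mul_zero]
  intro y hy
  rw [htx]
  exact hle y hy

end hull

/-! ### The length of the upper hull -/

theorem Curve1.integrableOn_speed1 (γ : Curve1) : IntegrableOn (speed1 γ) (Icc 0 1) := by
  refine Integrable.mono' (γ.dx_int.abs.add γ.dy_int.abs) ?_ (Eventually.of_forall fun t => ?_)
  · exact Real.continuous_sqrt.comp_aestronglyMeasurable
      ((γ.dx_int.aestronglyMeasurable.pow 2).add (γ.dy_int.aestronglyMeasurable.pow 2))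
  · rw [Real.norm_eq_abs, speed1, abs_of_nonneg (Real.sqrt_nonneg _)]
    simp only [Pi.add_apply]
    rw [Real.sqrt_le_left (add_nonneg (abs_nonneg _) (abs_nonneg _))]
    nlinarith [sq_abs (γ.dx t), sq_abs (γ.dy t), abs_nonneg (γ.dx t), abs_nonneg (γ.dy t),
      mul_nonneg (abs_nonneg (γ.dx t)) (abs_nonneg (γ.dy t))]

theorem Curve1.intervalIntegrable_speed1 (γ : Curve1) {s t : ℝ} (hs : s ∈ Icc (0:ℝ) 1)
    (ht : t ∈ Icc (0:ℝ) 1) : IntervalIntegrable (speed1 γ) volume s t := by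
  have h := (intervalIntegrable_iff_integrableOn_Icc_of_le zero_le_one).2 γ.integrableOn_speed1
  exact h.mono_set (uIcc_subset_uIcc (by simpa [mem_uIcc] using hs) (by simpa [mem_uIcc] using ht))

theorem Curve1.abs_y_sub_le (γ : Curve1) {s t : ℝ} (hs : 0 ≤ s) (hst : s ≤ t) (ht : t ≤ 1) :
    |γ.y t - γ.y s| ≤ ∫ r in s..t, speed1 γ r := by
  rw [γ.ftc_y_sub ⟨hs, hst.trans ht⟩ ⟨hs.trans hst, ht⟩, add_sub_cancel_left]
  have hdy : IntervalIntegrable γ.dy volume s t :=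
    (intervalIntegrable_iff_integrableOn_Icc_of_le hst).2 (γ.dy_int.mono_set (Icc_subset_Icc hs ht))
  refine (intervalIntegral.abs_integral_le_integral_abs hst).trans ?_
  refine intervalIntegral.integral_mono_on hst hdy.abs
    (γ.intervalIntegrable_speed1 ⟨hs, hst.trans ht⟩ ⟨hs.trans hst, ht⟩) fun r _ => ?_
  exact Real.abs_le_sqrt (by nlinarith [sq_nonneg (γ.dx r)])

section hull

variable {ψ : ℝ → ℝ} {γ : Curve} {u : ℝ → ℝ}

theorem IsUpperHull.notMem_contactSet (hγ : MemP ψ γ) (hu : IsUpperHull γ.x γ.y u) {t : ℝ}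
    (ht : t ∈ Icc (0:ℝ) 1) (hty : γ.y t ≠ u (γ.x t)) : γ.x t ∉ contactSet γ u := by
  rintro ⟨hx, s, hs, hsx, hsy⟩
  have hs' := hγ.mem_Ioo_of_x_mem hs (by rwa [hsx])
  have hd := hu.dx_pos hγ hs' (by rwa [hsx]) (by rw [hsy, hsx])
  obtain rfl := hγ.1.eq_of_x_eq ht hs' hd hsx.symm
  exact hty hsy

theorem IsUpperHull.dy_eq_deriv (hγ : MemP ψ γ) (hu : IsUpperHull γ.x γ.y u) {t : ℝ}
    (ht : t ∈ Ioo (0:ℝ) 1) (htx : γ.x t ∈ Ioo (0:ℝ) 1) (hty : γ.y t = u (γ.x t)) :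
    γ.dy t = deriv u (γ.x t) * γ.dx t :=
  hu.dy_eq hγ ht hty fun _ hy => hu.le_tangent hγ htx hy

theorem IsUpperHull.hasDerivAt_defect (hγ : MemP ψ γ) (hu : IsUpperHull γ.x γ.y u) {t : ℝ}
    (ht : t ∈ Ioo (0:ℝ) 1) (htx : γ.x t ∈ Ioo (0:ℝ) 1) {φ : ℝ → ℝ} (hφ : ∀ q, |φ q| ≤ 1) :
    HasDerivAt (fun t => φ (deriv u (γ.x t)) * (γ.y t - u (γ.x t)))
      (φ (deriv u (γ.x t)) * (γ.dy t - deriv u (γ.x t) * γ.dx t)) t := by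
  have hD : HasDerivAt (fun t => γ.y t - u (γ.x t)) (γ.dy t - deriv u (γ.x t) * γ.dx t) t :=
    (γ.hasDerivAt_y ht).sub
      ((hu.differentiableAt hγ htx).hasDerivAt.comp t (γ.hasDerivAt_x ht))
  by_cases hty : γ.y t = u (γ.x t)
  · have h0 := hu.dy_eq_deriv hγ ht htx hty
    rw [h0, sub_self, mul_zero]
    rw [h0, sub_self, hasDerivAt_iff_isLittleO] at hD
    rw [hasDerivAt_iff_isLittleO]
    refine (Asymptotics.IsBigO.of_bound 1 (Eventually.of_forall fun s => ?_)).trans_isLittleO hD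
    simp only [hty, sub_self, mul_zero, sub_zero, smul_zero, one_mul, norm_mul, Real.norm_eq_abs]
    exact mul_le_of_le_one_left (abs_nonneg _) (hφ _)
  · obtain ⟨c, hc, d, hd, -, -, h⟩ := hu.deriv_eventually_const hγ htx
      (hu.notMem_contactSet hγ (Ioo_subset_Icc_self ht) hty)
    refine (hD.const_mul (φ (deriv u (γ.x t)))).congr_of_eventuallyEq ?_
    filter_upwards [(γ.hasDerivAt_x ht).continuousAt.eventually (Icc_mem_nhds hc hd)] with s hs
    rw [h _ hs]

theorem IsUpperHull.integral_sqrt_le_aux (hγ : MemP ψ γ) (hu : IsUpperHull γ.x γ.y u)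
    {a b : ℝ} (ha : a ∈ Ioo (0:ℝ) 1) (hb : b ∈ Ioo (0:ℝ) 1) (hab : a ≤ b)
    (hax : 0 < γ.x a) (hbx : γ.x b < 1) :
    ∫ x in γ.x a..γ.x b, √(1 + deriv u x ^ 2) ≤
      (∫ t in a..b, speed1 γ.toCurve1 t) + |γ.y a - u (γ.x a)| + |γ.y b - u (γ.x b)| := by
  have hsub : Icc a b ⊆ Ioo 0 1 := fun t ht => ⟨ha.1.trans_le ht.1, ht.2.trans_lt hb.2⟩
  have hX : ∀ t ∈ Icc a b, γ.x t ∈ Ioo (0:ℝ) 1 := fun t ht =>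
    ⟨hax.trans_le (hγ.1.monotoneOn_x (Ioo_subset_Icc_self ha)
      (Ioo_subset_Icc_self (hsub ht)) ht.1),
    (hγ.1.monotoneOn_x (Ioo_subset_Icc_self (hsub ht))
      (Ioo_subset_Icc_self hb) ht.2).trans_lt hbx⟩
  have hcX : ContinuousOn γ.x (Icc a b) :=
    γ.continuousOn_x.mono (hsub.trans Ioo_subset_Icc_self)
  have hcp : ContinuousOn (fun t => deriv u (γ.x t)) (Icc a b) :=
    (hu.continuousOn_deriv hγ).comp hcX hX
  have hcdx : ContinuousOn γ.dx (Icc a b) := γ.continuousOn_dx.mono hsub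
  have hcdy : ContinuousOn γ.dy (Icc a b) := γ.continuousOn_dy.mono hsub
  set φ : ℝ → ℝ := fun q => q / √(1 + q ^ 2) with hφ
  have hpos : ∀ q : ℝ, 0 < √(1 + q ^ 2) := fun q => Real.sqrt_pos.2 (by positivity)
  have hφ1 : ∀ q, |φ q| ≤ 1 := by
    intro q
    rw [hφ, abs_div, abs_of_pos (hpos q), div_le_one (hpos q)]
    exact Real.abs_le_sqrt (by linarith)
  have hφc : Continuous φ := by
    refine continuous_id.div (by fun_prop) fun q => (hpos q).ne'
  have hsq : Continuous fun q : ℝ => √(1 + q ^ 2) := by fun_prop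
  have hH := intervalIntegral.integral_eq_sub_of_hasDerivAt (a := a) (b := b)
    (fun t ht => hu.hasDerivAt_defect hγ (hsub (by rwa [uIcc_of_le hab] at ht))
      (hX t (by rwa [uIcc_of_le hab] at ht)) hφ1)
    (ContinuousOn.intervalIntegrable (by
      rw [uIcc_of_le hab]
      exact (hφc.comp_continuousOn hcp).mul (hcdy.sub (hcp.mul hcdx))))
  have hG : ∫ t in a..b, √(1 + deriv u (γ.x t) ^ 2) * γ.dx t =
      ∫ x in γ.x a..γ.x b, √(1 + deriv u x ^ 2) := by
    refine intervalIntegral.integral_comp_mul_deriv'' (g := fun x => √(1 + deriv u x ^ 2))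
      (by rwa [uIcc_of_le hab]) ?_ (by rwa [uIcc_of_le hab]) ?_
    · rw [min_eq_left hab, max_eq_right hab]
      exact fun t ht => (γ.hasDerivAt_x (hsub (Ioo_subset_Icc_self ht))).hasDerivWithinAt
    · rw [uIcc_of_le hab]
      refine hsq.comp_continuousOn ((hu.continuousOn_deriv hγ).mono ?_)
      rintro _ ⟨t, ht, rfl⟩
      exact hX t ht
  have hle : ∀ t ∈ Icc a b, φ (deriv u (γ.x t)) * (γ.dy t - deriv u (γ.x t) * γ.dx t) +
      √(1 + deriv u (γ.x t) ^ 2) * γ.dx t ≤ speed1 γ.toCurve1 t := by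
    intro t _
    set q := deriv u (γ.x t)
    have hr := hpos q
    have hr2 : √(1 + q ^ 2) ^ 2 = 1 + q ^ 2 := Real.sq_sqrt (by positivity)
    set r := √(1 + q ^ 2)
    have e : φ q * (γ.dy t - q * γ.dx t) + r * γ.dx t = (q * γ.dy t + γ.dx t) / r := by
      have : φ q = q / r := rfl
      rw [this]
      field_simp
      rw [hr2]; ring
    rw [e]
    refine Real.le_sqrt_of_sq_le ?_
    rw [div_pow, hr2, div_le_iff₀ (by positivity)]
    nlinarith [sq_nonneg (γ.dy t - q * γ.dx t)]
  have hI1 : IntervalIntegrable (fun t => φ (deriv u (γ.x t)) *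
      (γ.dy t - deriv u (γ.x t) * γ.dx t)) volume a b :=
    ContinuousOn.intervalIntegrable (by
      rw [uIcc_of_le hab]
      exact (hφc.comp_continuousOn hcp).mul (hcdy.sub (hcp.mul hcdx)))
  have hI2 : IntervalIntegrable (fun t => √(1 + deriv u (γ.x t) ^ 2) * γ.dx t) volume a b :=
    ContinuousOn.intervalIntegrable (by
      rw [uIcc_of_le hab]
      exact (hsq.comp_continuousOn hcp).mul hcdx)
  have hint := intervalIntegral.integral_mono_on hab (hI1.add hI2)
    (γ.intervalIntegrable_speed1 (Ioo_subset_Icc_self ha) (Ioo_subset_Icc_self hb)) hle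
  rw [intervalIntegral.integral_add hI1 hI2, hH, hG] at hint
  have ba : |φ (deriv u (γ.x a)) * (γ.y a - u (γ.x a))| ≤ |γ.y a - u (γ.x a)| := by
    rw [abs_mul]; exact mul_le_of_le_one_left (abs_nonneg _) (hφ1 _)
  have bb : |φ (deriv u (γ.x b)) * (γ.y b - u (γ.x b))| ≤ |γ.y b - u (γ.x b)| := by
    rw [abs_mul]; exact mul_le_of_le_one_left (abs_nonneg _) (hφ1 _)
  linarith [(abs_le.1 ba).2, (abs_le.1 bb).1]

theorem IsUpperHull.integral_sqrt_le (hγ : MemP ψ γ) (hu : IsUpperHull γ.x γ.y u)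
    {x x' : ℝ} (hx : 0 < x) (hxx : x < x') (hx' : x' < 1) :
    u 0 + u 1 + ∫ x in x..x', √(1 + deriv u x ^ 2) ≤
      (∫ t in (0:ℝ)..1, speed1 γ.toCurve1 t) + |u x - u 0| + |u x' - u 1| := by
  have hex : ∀ z ∈ Ioo (0:ℝ) 1, ∃ t ∈ Ioo (0:ℝ) 1, γ.x t = z := by
    intro z hz
    refine intermediate_value_Ioo zero_le_one γ.continuousOn_x ?_
    rwa [hγ.2.1, hγ.2.2.2.1]
  obtain ⟨a, ha, rfl⟩ := hex x ⟨hx, hxx.trans hx'⟩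
  obtain ⟨b, hb, rfl⟩ := hex x' ⟨hx.trans hxx, hx'⟩
  obtain ⟨s, hs, hsx, hsy⟩ := hu.touch_zero
  obtain ⟨r, hr, hrx, hry⟩ := hu.touch_one
  have hm := hγ.1.monotoneOn_x
  have hab : a ≤ b := by
    by_contra! h
    exact absurd (hm (Ioo_subset_Icc_self hb) (Ioo_subset_Icc_self ha) h.le) (not_le.2 hxx)
  have hsa : s ≤ a := by
    by_contra! h
    have := hm (Ioo_subset_Icc_self ha) hs h.le
    linarith
  have hbr : b ≤ r := by
    by_contra! h
    have := hm hr (Ioo_subset_Icc_self hb) h.le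
    linarith
  have h0 : (0:ℝ) ∈ Icc (0:ℝ) 1 := by simp
  have h1 : (1:ℝ) ∈ Icc (0:ℝ) 1 := by simp
  have ha' := Ioo_subset_Icc_self ha
  have hb' := Ioo_subset_Icc_self hb
  have key := hu.integral_sqrt_le_aux hγ ha hb hab hx hx'
  have e1 := γ.abs_y_sub_le le_rfl hs.1 hs.2
  have e2 := γ.abs_y_sub_le hs.1 hsa ha.2.le
  have e3 := γ.abs_y_sub_le hb.1.le hbr hr.2
  have e4 := γ.abs_y_sub_le hr.1 hr.2 le_rfl
  have i1 := intervalIntegral.integral_add_adjacent_intervals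
    (γ.intervalIntegrable_speed1 h0 hs) (γ.intervalIntegrable_speed1 hs ha')
  have i2 := intervalIntegral.integral_add_adjacent_intervals
    (γ.intervalIntegrable_speed1 h0 ha') (γ.intervalIntegrable_speed1 ha' hb')
  have i3 := intervalIntegral.integral_add_adjacent_intervals
    (γ.intervalIntegrable_speed1 h0 hb') (γ.intervalIntegrable_speed1 hb' hr)
  have i4 := intervalIntegral.integral_add_adjacent_intervals
    (γ.intervalIntegrable_speed1 h0 hr) (γ.intervalIntegrable_speed1 hr h1)
  have t1 : |γ.y a - u (γ.x a)| ≤ |γ.y a - γ.y s| + |u (γ.x a) - u 0| := by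
    rw [← hsy, abs_sub_comm (u _)]
    have := abs_add_le (γ.y a - γ.y s) (γ.y s - u (γ.x a))
    rwa [sub_add_sub_cancel] at this
  have t2 : |γ.y b - u (γ.x b)| ≤ |γ.y r - γ.y b| + |u (γ.x b) - u 1| := by
    rw [← hry, abs_sub_comm (u _), abs_sub_comm (γ.y r)]
    have := abs_add_le (γ.y b - γ.y r) (γ.y r - u (γ.x b))
    rwa [sub_add_sub_cancel] at this
  rw [hγ.2.2.1, sub_zero, hsy] at e1
  rw [hγ.2.2.2.2.1, zero_sub, abs_neg, hry] at e4
  linarith [le_abs_self (u 0), le_abs_self (u 1)]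

theorem IsUpperHull.integrableOn_sqrt (hγ : MemP ψ γ) (hu : IsUpperHull γ.x γ.y u) :
    IntegrableOn (fun x => √(1 + deriv u x ^ 2)) (Ioc 0 1) := by
  have hc0 : Tendsto (fun x => |u x - u 0|) (𝓝[Icc 0 1] 0) (𝓝 0) := by
    simpa using ((hu.cont 0 (by simp)).sub
      (continuousWithinAt_const (b := u 0))).abs.tendsto
  have hc1 : Tendsto (fun x => |u x - u 1|) (𝓝[Icc 0 1] 1) (𝓝 0) := by
    simpa using ((hu.cont 1 (by simp)).sub
      (continuousWithinAt_const (b := u 1))).abs.tendsto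
  have hz : Tendsto (fun n : ℕ => 1 / ((n:ℝ) + 3)) atTop (𝓝 0) :=
    tendsto_const_nhds.div_atTop
      (tendsto_atTop_add_const_right _ _ tendsto_natCast_atTop_atTop)
  have hpos : ∀ n : ℕ, 0 < 1 / ((n:ℝ) + 3) := fun n => by positivity
  have hle : ∀ n : ℕ, 1 / ((n:ℝ) + 3) < 1 / 2 := fun n => by
    have : (0:ℝ) ≤ n := n.cast_nonneg
    rw [div_lt_div_iff₀ (by positivity) (by positivity)]
    linarith
  have hz' : Tendsto (fun n : ℕ => 1 - 1 / ((n:ℝ) + 3)) atTop (𝓝 1) := by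
    simpa using hz.const_sub 1
  have hs0 : Tendsto (fun n : ℕ => 1 / ((n:ℝ) + 3)) atTop (𝓝[Icc 0 1] 0) :=
    tendsto_nhdsWithin_iff.2 ⟨hz, Eventually.of_forall fun n =>
      ⟨(hpos n).le, by linarith [hle n]⟩⟩
  have hs1 : Tendsto (fun n : ℕ => 1 - 1 / ((n:ℝ) + 3)) atTop (𝓝[Icc 0 1] 1) :=
    tendsto_nhdsWithin_iff.2 ⟨hz', Eventually.of_forall fun n =>
      ⟨by linarith [hle n], by linarith [hpos n]⟩⟩
  refine integrableOn_Ioc_of_intervalIntegral_norm_bounded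
    (I := (∫ t in (0:ℝ)..1, speed1 γ.toCurve1 t) + 1 + 1 - u 0 - u 1)
    (a := fun n : ℕ => 1 / ((n:ℝ) + 3)) (b := fun n : ℕ => 1 - 1 / ((n:ℝ) + 3)) (l := atTop)
    (fun n => ?_) hz hz' ?_
  · have h : ContinuousOn (fun x => √(1 + deriv u x ^ 2))
        (Icc (1 / ((n:ℝ) + 3)) (1 - 1 / ((n:ℝ) + 3))) := by
      refine ContinuousOn.sqrt (continuousOn_const.add (((hu.continuousOn_deriv hγ).mono
        fun x hx => ⟨(hpos n).trans_le hx.1, hx.2.trans_lt ?_⟩).pow 2))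
      linarith [hpos n]
    exact h.integrableOn_Icc.mono_set Ioc_subset_Icc_self
  · have h0 := (hc0.comp hs0).eventually (gt_mem_nhds one_pos)
    have h1 := (hc1.comp hs1).eventually (gt_mem_nhds one_pos)
    filter_upwards [h0, h1] with n h0 h1
    have h2 := hu.integral_sqrt_le hγ (hpos n) (x' := 1 - 1 / ((n:ℝ) + 3))
      (by linarith [hle n]) (by linarith [hpos n])
    simp only [Function.comp_apply] at h0 h1
    rw [← intervalIntegral.integral_of_le (by linarith [hle n])]
    simp only [Real.norm_eq_abs, abs_of_nonneg (Real.sqrt_nonneg _)]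
    linarith

/-- The length of the upper hull, vertical parts included, is at most that of the curve. -/
theorem IsUpperHull.length_le (hγ : MemP ψ γ) (hu : IsUpperHull γ.x γ.y u) :
    u 0 + u 1 + ∫ x in (0:ℝ)..1, √(1 + deriv u x ^ 2) ≤
      ∫ t in (0:ℝ)..1, speed1 γ.toCurve1 t := by
  have hi : IntervalIntegrable (fun x => √(1 + deriv u x ^ 2)) volume 0 1 :=
    (intervalIntegrable_iff_integrableOn_Ioc_of_le zero_le_one).2 (hu.integrableOn_sqrt hγ)
  have hF := intervalIntegral.continuousOn_primitive_interval' hi (a := 0) (by simp)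
  rw [uIcc_of_le zero_le_one] at hF
  have h0 : ContinuousWithinAt (fun x => u 0 + u 1 + ((∫ s in (0:ℝ)..(1 - x),
      √(1 + deriv u s ^ 2)) - ∫ s in (0:ℝ)..x, √(1 + deriv u s ^ 2)) - |u x - u 0|
      - |u (1 - x) - u 1|) (Icc 0 1) 0 := by
    have hr : ContinuousWithinAt (fun x : ℝ => 1 - x) (Icc 0 1) 0 := by fun_prop
    have hmt : MapsTo (fun x : ℝ => 1 - x) (Icc 0 1) (Icc 0 1) := fun x hx =>
      ⟨by linarith [hx.2], by linarith [hx.1]⟩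
    have hF1 := ContinuousWithinAt.comp (x := 0) (hF (1 - 0) (by simp)) hr hmt
    have hu1 := ContinuousWithinAt.comp (x := 0) (hu.cont (1 - 0) (by simp)) hr hmt
    exact ((continuousWithinAt_const.add (hF1.sub (hF 0 (by simp)))).sub
      ((hu.cont 0 (by simp)).sub continuousWithinAt_const).abs).sub
      (hu1.sub continuousWithinAt_const).abs
  have hT := h0.tendsto
  simp only [sub_zero, intervalIntegral.integral_same, sub_self, abs_zero] at hT
  have hne : (𝓝[Ioo 0 1] (0:ℝ)).NeBot := by
    rw [nhdsWithin_Ioo_eq_nhdsGT (zero_lt_one (α := ℝ))]; infer_instance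
  refine le_of_tendsto (hT.mono_left (nhdsWithin_mono _ Ioo_subset_Icc_self)) ?_
  rw [nhdsWithin_Ioo_eq_nhdsGT (zero_lt_one (α := ℝ))]
  filter_upwards [Ioo_mem_nhdsGT (show (0:ℝ) < 1 / 2 by norm_num)] with x hx
  have hx1 : x < 1 - x := by linarith [hx.2]
  have h2 := hu.integral_sqrt_le hγ hx.1 hx1 (by linarith [hx.1])
  rw [← intervalIntegral.integral_interval_sub_left (a := 0)
    (hi.mono_set (uIcc_subset_uIcc (by simp) (by
      rw [mem_uIcc]; left; constructor <;> linarith [hx.1, hx.2])))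
    (hi.mono_set (uIcc_subset_uIcc (by simp) (by
      rw [mem_uIcc]; left; constructor <;> linarith [hx.1, hx.2])))] at h2
  linarith

end hull

/-! ### The cap over a concave profile -/

theorem W22locOn.mono {u du ddu : ℝ → ℝ} {c d c' d' : ℝ} (h : W22locOn u du ddu c d)
    (hc : c ≤ c') (hd : d' ≤ d) : W22locOn u du ddu c' d' where
  du_loc a b ha hb := h.du_loc a b (hc.trans_lt ha) (hb.trans_le hd)
  ddu_loc a b ha hb := h.ddu_loc a b (hc.trans_lt ha) (hb.trans_le hd)
  ddu_sq a b ha hb := h.ddu_sq a b (hc.trans_lt ha) (hb.trans_le hd)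
  ftc_u a ha t ht := h.ftc_u a (Ioo_subset_Ioo hc hd ha) t (Ioo_subset_Ioo hc hd ht)
  ftc_du a ha t ht := h.ftc_du a (Ioo_subset_Ioo hc hd ha) t (Ioo_subset_Ioo hc hd ht)

theorem Real.dist_arctan_le (x y : ℝ) : dist (Real.arctan x) (Real.arctan y) ≤ dist x y := by
  have h : LipschitzWith 1 Real.arctan := by
    refine lipschitzWith_of_nnnorm_deriv_le Real.differentiable_arctan fun x => ?_
    rw [← NNReal.coe_le_coe, coe_nnnorm, Real.deriv_arctan, Real.norm_eq_abs, NNReal.coe_one,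
      abs_of_pos (by positivity), div_le_one (by positivity)]
    nlinarith [sq_nonneg x]
  simpa using h.dist_le_mul x y

/-- A concave profile over `[0,1]` with nonnegative end values, of finite length, and with a
vertical tangent at each end where it is positive. -/
structure CapProfile (u : ℝ → ℝ) : Prop where
  cont : ContinuousOn u (Icc 0 1)
  zero_nonneg : 0 ≤ u 0
  one_nonneg : 0 ≤ u 1
  diff : ∀ x ∈ Ioo (0:ℝ) 1, DifferentiableAt ℝ u x
  anti : AntitoneOn (deriv u) (Ioo 0 1)
  reg : W22locOn u (deriv u) (deriv (deriv u)) 0 1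
  int : IntegrableOn (fun x => √(1 + deriv u x ^ 2)) (Ioc 0 1)
  vert_zero : 0 < u 0 → ∀ M, ∃ x ∈ Ioo (0:ℝ) 1, M < deriv u x
  vert_one : 0 < u 1 → ∀ M, ∃ x ∈ Ioo (0:ℝ) 1, deriv u x < M

theorem IsUpperHull.capProfile {ψ : ℝ → ℝ} {γ : Curve} {u : ℝ → ℝ} (hγ : MemP ψ γ)
    (hu : IsUpperHull γ.x γ.y u) : CapProfile u where
  cont := hu.cont
  zero_nonneg := by
    have := hu.above 0 (by simp)
    rwa [hγ.2.1, hγ.2.2.1] at this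
  one_nonneg := by
    have := hu.above 1 (by simp)
    rwa [hγ.2.2.2.1, hγ.2.2.2.2.1] at this
  diff _ hx := hu.differentiableAt hγ hx
  anti := hu.antitoneOn_deriv hγ
  reg := hu.w22locOn hγ
  int := hu.integrableOn_sqrt hγ
  vert_zero := hu.exists_lt_deriv hγ
  vert_one := hu.exists_deriv_lt hγ

namespace CapProfile

variable (u : ℝ → ℝ)

/-- The length element of the graph of `u`, extended by `1` outside `(0,1)`. -/
def weight (x : ℝ) : ℝ := open Classical in if x ∈ Ioo (0:ℝ) 1 then √(1 + deriv u x ^ 2) else 1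

/-- The length of the cap over `u`. -/
def len : ℝ := u 0 + u 1 + ∫ x in (0:ℝ)..1, √(1 + deriv u x ^ 2)

/-- The constant-speed parameter of the cap at abscissa `x`. -/
def param (x : ℝ) : ℝ := (u 0 + ∫ s in (0:ℝ)..x, weight u s) / len u

variable {u}

theorem one_le_weight (x : ℝ) : 1 ≤ weight u x := by
  unfold weight
  split_ifs
  · exact Real.one_le_sqrt.2 (by nlinarith [sq_nonneg (deriv u x)])
  · exact le_rfl

theorem weight_of_mem {x : ℝ} (hx : x ∈ Ioo (0:ℝ) 1) : weight u x = √(1 + deriv u x ^ 2) :=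
  if_pos hx

theorem integral_weight : ∫ x in (0:ℝ)..1, weight u x = ∫ x in (0:ℝ)..1, √(1 + deriv u x ^ 2) := by
  rw [intervalIntegral.integral_of_le zero_le_one, intervalIntegral.integral_of_le zero_le_one,
    integral_Ioc_eq_integral_Ioo, integral_Ioc_eq_integral_Ioo]
  exact setIntegral_congr_fun measurableSet_Ioo fun x hx => weight_of_mem hx

variable (h : CapProfile u)

include h

theorem intervalIntegrable_weight (a b : ℝ) : IntervalIntegrable (weight u) volume a b := by
  have h1 : weight u = fun x => (Ioo (0:ℝ) 1).indicator (fun x => √(1 + deriv u x ^ 2)) x +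
      (Ioo (0:ℝ) 1)ᶜ.indicator (fun _ => 1) x := by
    ext x
    by_cases hx : x ∈ Ioo (0:ℝ) 1 <;> simp [weight, hx]
  rw [h1]
  refine IntervalIntegrable.add ?_ ?_
  · exact ((h.int.mono_set Ioo_subset_Ioc_self).integrable_indicator
      measurableSet_Ioo).intervalIntegrable
  · rw [intervalIntegrable_iff]
    exact (integrableOn_const (by simp)).indicator measurableSet_Ioo.compl

theorem len_pos : 0 < len u := by
  have h1 := intervalIntegral.integral_mono_on zero_le_one intervalIntegrable_const
    (h.intervalIntegrable_weight 0 1) fun x _ => one_le_weight (u := u) x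
  rw [integral_weight] at h1
  simp only [intervalIntegral.integral_const, sub_zero, smul_eq_mul, mul_one] at h1
  have := h.zero_nonneg
  have := h.one_nonneg
  unfold len
  linarith

theorem param_sub (x y : ℝ) : param u y - param u x = (∫ s in x..y, weight u s) / len u := by
  rw [param, param, ← sub_div, ← intervalIntegral.integral_interval_sub_left
    (h.intervalIntegrable_weight 0 y) (h.intervalIntegrable_weight 0 x)]
  congr 1; ring

theorem sub_le_param {x y : ℝ} (hxy : x ≤ y) : (y - x) / len u ≤ param u y - param u x := by
  rw [h.param_sub]
  have h1 := intervalIntegral.integral_mono_on hxy intervalIntegrable_const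
    (h.intervalIntegrable_weight x y) fun x _ => one_le_weight (u := u) x
  simp only [intervalIntegral.integral_const, smul_eq_mul, mul_one] at h1
  exact div_le_div_of_nonneg_right h1 h.len_pos.le

theorem strictMono_param : StrictMono (param u) := fun x y hxy => by
  have h1 := h.sub_le_param hxy.le
  have h2 := div_pos (sub_pos.2 hxy) h.len_pos
  linarith

theorem continuous_param : Continuous (param u) :=
  (continuous_const.add (intervalIntegral.continuous_primitive
    h.intervalIntegrable_weight 0)).div_const _

theorem surjective_param : Function.Surjective (param u) := by
  have hL := h.len_pos
  refine h.continuous_param.surjective ?_ ?_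
  · refine tendsto_atTop_mono' atTop (f₁ := fun x => param u 0 + x / len u) ?_ ?_
    · filter_upwards [eventually_ge_atTop 0] with x hx
      have := h.sub_le_param hx
      rw [sub_zero] at this
      linarith
    · exact tendsto_atTop_add_const_left _ _ (tendsto_id.atTop_div_const hL)
  · refine tendsto_atBot_mono' atBot (f₁ := fun x => param u 0 + x / len u) ?_ ?_
    · filter_upwards [eventually_le_atBot 0] with x hx
      have := h.sub_le_param hx
      rw [zero_sub, neg_div] at this
      linarith
    · exact tendsto_atBot_add_const_left _ _ (tendsto_id.atBot_div_const hL)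

/-- The abscissa as a function of the constant-speed parameter. -/
def absc : ℝ ≃o ℝ :=
  (StrictMono.orderIsoOfSurjective (param u) h.strictMono_param h.surjective_param).symm

theorem param_absc (t : ℝ) : param u (h.absc t) = t :=
  (StrictMono.orderIsoOfSurjective (param u) h.strictMono_param
    h.surjective_param).apply_symm_apply t

theorem absc_param (x : ℝ) : h.absc (param u x) = x :=
  (StrictMono.orderIsoOfSurjective (param u) h.strictMono_param
    h.surjective_param).symm_apply_apply x

theorem dist_absc_le (s t : ℝ) : dist (h.absc s) (h.absc t) ≤ len u * dist s t := by
  wlog hst : s ≤ t generalizing s t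
  · rw [dist_comm, dist_comm s]
    exact this t s (le_of_not_ge hst)
  have h1 := h.sub_le_param (h.absc.monotone hst)
  rw [h.param_absc, h.param_absc, div_le_iff₀ h.len_pos] at h1
  have h2 := h.absc.monotone hst
  rw [Real.dist_eq, Real.dist_eq, abs_sub_comm, abs_of_nonneg (by linarith), abs_sub_comm,
    abs_of_nonneg (by linarith)]
  linarith

theorem param_zero_nonneg : 0 ≤ param u 0 := by
  simp only [param, intervalIntegral.integral_same, add_zero]
  exact div_nonneg h.zero_nonneg h.len_pos.le

theorem len_mul_param_zero : len u * param u 0 = u 0 := by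
  simp only [param, intervalIntegral.integral_same, add_zero]
  rw [mul_div_cancel₀ _ h.len_pos.ne']

theorem len_mul_param_one : len u * param u 1 = len u - u 1 := by
  have hL := h.len_pos
  rw [param, integral_weight, mul_div_cancel₀ _ h.len_pos.ne', len]
  ring

theorem param_one_le : param u 1 ≤ 1 := by
  have h1 := h.len_mul_param_one
  have h2 := h.one_nonneg
  have h3 := h.len_pos
  by_contra! h4
  nlinarith

theorem absc_mem_Ioo {t : ℝ} : h.absc t ∈ Ioo (0:ℝ) 1 ↔ t ∈ Ioo (param u 0) (param u 1) := by
  have h0 := h.strictMono_param.lt_iff_lt (a := 0) (b := h.absc t)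
  have h1 := h.strictMono_param.lt_iff_lt (a := h.absc t) (b := 1)
  rw [h.param_absc] at h0 h1
  rw [mem_Ioo, mem_Ioo, h0, h1]

theorem absc_le_zero {t : ℝ} : h.absc t ≤ 0 ↔ t ≤ param u 0 := by
  have h0 := h.strictMono_param.le_iff_le (a := h.absc t) (b := 0)
  rwa [h.param_absc, iff_comm] at h0

theorem one_le_absc {t : ℝ} : 1 ≤ h.absc t ↔ param u 1 ≤ t := by
  have h0 := h.strictMono_param.le_iff_le (a := 1) (b := h.absc t)
  rwa [h.param_absc, iff_comm] at h0

theorem continuousOn_deriv : ContinuousOn (deriv u) (Ioo (0:ℝ) 1) :=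
  continuousOn_of_ftc h.reg.ddu_loc h.reg.ftc_du

theorem hasDerivAt_param {x : ℝ} (hx : x ∈ Ioo (0:ℝ) 1) :
    HasDerivAt (param u) (√(1 + deriv u x ^ 2) / len u) x := by
  have hc : ContinuousOn (weight u) (Ioo 0 1) :=
    (ContinuousOn.sqrt (continuousOn_const.add (h.continuousOn_deriv.pow 2))).congr
      fun x hx => weight_of_mem hx
  have h1 := intervalIntegral.integral_hasDerivAt_right (h.intervalIntegrable_weight 0 x)
    (hc.stronglyMeasurableAtFilter isOpen_Ioo x hx) (hc.continuousAt (isOpen_Ioo.mem_nhds hx))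
  rw [weight_of_mem hx] at h1
  exact (h1.const_add (u 0)).div_const _

theorem hasDerivAt_absc {t : ℝ} (ht : t ∈ Ioo (param u 0) (param u 1)) :
    HasDerivAt h.absc (len u * Real.cos (Real.arctan (deriv u (h.absc t)))) t := by
  have hx := h.absc_mem_Ioo.2 ht
  have hpos : 0 < √(1 + deriv u (h.absc t) ^ 2) := Real.sqrt_pos.2 (by positivity)
  have h1 := HasDerivAt.of_local_left_inverse h.absc.continuous.continuousAt
    (h.hasDerivAt_param hx) (div_pos hpos h.len_pos).ne'
    (Eventually.of_forall fun y => h.param_absc y)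
  refine h1.congr_deriv ?_
  rw [Real.cos_arctan, inv_div]
  ring

/-- The tangent angle of the cap. -/
def angle (t : ℝ) : ℝ :=
  if t ≤ param u 0 then Real.pi / 2 else if param u 1 ≤ t then - (Real.pi / 2)
  else Real.arctan (deriv u (h.absc t))

theorem angle_of_le {t : ℝ} (ht : t ≤ param u 0) : h.angle t = Real.pi / 2 := if_pos ht

theorem param_zero_lt : param u 0 < param u 1 := h.strictMono_param zero_lt_one

theorem angle_of_ge {t : ℝ} (ht : param u 1 ≤ t) : h.angle t = - (Real.pi / 2) := by
  rw [angle, if_neg (not_le.2 (h.param_zero_lt.trans_le ht)), if_pos ht]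

theorem angle_of_mem {t : ℝ} (ht : t ∈ Ioo (param u 0) (param u 1)) :
    h.angle t = Real.arctan (deriv u (h.absc t)) := by
  rw [angle, if_neg (not_le.2 ht.1), if_neg (not_le.2 ht.2)]

theorem angle_mem (t : ℝ) : h.angle t ∈ Icc (- (Real.pi / 2)) (Real.pi / 2) := by
  have := Real.pi_pos
  unfold angle
  split_ifs
  · constructor <;> linarith
  · constructor <;> linarith
  · exact ⟨(Real.neg_pi_div_two_lt_arctan _).le, (Real.arctan_lt_pi_div_two _).le⟩

theorem antitone_angle : Antitone h.angle := by
  intro s t hst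
  rcases le_or_gt s (param u 0) with h1 | h1
  · rw [h.angle_of_le h1]
    exact (h.angle_mem t).2
  rcases le_or_gt (param u 1) t with h2 | h2
  · rw [h.angle_of_ge h2]
    exact (h.angle_mem s).1
  have hs : s ∈ Ioo (param u 0) (param u 1) := ⟨h1, hst.trans_lt h2⟩
  have ht : t ∈ Ioo (param u 0) (param u 1) := ⟨h1.trans_le hst, h2⟩
  rw [h.angle_of_mem hs, h.angle_of_mem ht]
  exact Real.arctan_strictMono.monotone
    (h.anti (h.absc_mem_Ioo.2 hs) (h.absc_mem_Ioo.2 ht) (h.absc.monotone hst))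

theorem continuousOn_angle : ContinuousOn h.angle (Ioo 0 1) := by
  intro t ht
  refine ContinuousAt.continuousWithinAt ?_
  have hL := h.len_pos
  rcases lt_trichotomy t (param u 0) with h1 | h1 | h1
  · refine (continuousAt_const (y := Real.pi / 2)).congr ?_
    filter_upwards [Iio_mem_nhds h1] with s hs using (h.angle_of_le (le_of_lt hs)).symm
  · have hu0 : 0 < u 0 := by
      rw [← h.len_mul_param_zero, ← h1]
      exact mul_pos hL ht.1
    refine tendsto_order.2 ⟨fun c hc => ?_, fun c hc => ?_⟩
    · rw [h.angle_of_le h1.le] at hc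
      obtain ⟨M, hM⟩ := ((Real.tendsto_arctan_atTop.mono_right nhdsWithin_le_nhds).eventually
        (lt_mem_nhds hc)).exists
      obtain ⟨x, hx, hMx⟩ := h.vert_zero hu0 M
      have hx' : h.absc (param u x) ∈ Ioo (0:ℝ) 1 := by rwa [h.absc_param]
      have hx'' := h.absc_mem_Ioo.1 hx'
      rw [h1]
      filter_upwards [Iio_mem_nhds hx''.1] with s hs
      have h2 := h.antitone_angle (le_of_lt hs)
      rw [h.angle_of_mem hx'', h.absc_param] at h2
      exact hM.trans ((Real.arctan_strictMono hMx).trans_le h2)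
    · rw [h.angle_of_le h1.le] at hc
      exact Eventually.of_forall fun s => (h.angle_mem s).2.trans_lt hc
  rcases lt_trichotomy t (param u 1) with h2 | h2 | h2
  · have hx := h.absc_mem_Ioo.2 ⟨h1, h2⟩
    have hc : ContinuousAt (fun s => Real.arctan (deriv u (h.absc s))) t :=
      Real.continuous_arctan.continuousAt.comp (ContinuousAt.comp
        (h.continuousOn_deriv.continuousAt (isOpen_Ioo.mem_nhds hx))
        h.absc.continuous.continuousAt)
    refine hc.congr ?_
    filter_upwards [Ioo_mem_nhds h1 h2] with s hs using (h.angle_of_mem hs).symm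
  · have hu1 : 0 < u 1 := by
      have := h.len_mul_param_one
      rw [← h2] at this
      nlinarith [ht.2]
    refine tendsto_order.2 ⟨fun c hc => ?_, fun c hc => ?_⟩
    · rw [h.angle_of_ge h2.ge] at hc
      exact Eventually.of_forall fun s => hc.trans_le (h.angle_mem s).1
    · rw [h.angle_of_ge h2.ge] at hc
      obtain ⟨M, hM⟩ := ((Real.tendsto_arctan_atBot.mono_right nhdsWithin_le_nhds).eventually
        (gt_mem_nhds hc)).exists
      obtain ⟨x, hx, hMx⟩ := h.vert_one hu1 M
      have hx' : h.absc (param u x) ∈ Ioo (0:ℝ) 1 := by rwa [h.absc_param]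
      have hx'' := h.absc_mem_Ioo.1 hx'
      rw [h2]
      filter_upwards [Ioi_mem_nhds hx''.2] with s hs
      have h3 := h.antitone_angle (le_of_lt hs)
      rw [h.angle_of_mem hx'', h.absc_param] at h3
      exact (h3.trans_lt (Real.arctan_strictMono hMx)).trans hM
  · refine (continuousAt_const (y := - (Real.pi / 2))).congr ?_
    filter_upwards [Ioi_mem_nhds h2] with s hs using (h.angle_of_ge (le_of_lt hs)).symm

theorem absolutelyContinuousOnInterval_angle {a b : ℝ} (ha : a ∈ Ioo (0:ℝ) 1)
    (hb : b ∈ Ioo (0:ℝ) 1) : AbsolutelyContinuousOnInterval h.angle a b := by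
  wlog hab : a ≤ b generalizing a b
  · exact (this hb ha (le_of_not_ge hab)).symm
  have hid : ∀ c d : ℝ, AbsolutelyContinuousOnInterval (fun x : ℝ => x) c d := fun c d =>
    ((LipschitzWith.id (α := ℝ)).lipschitzOnWith (s := uIcc c d)).absolutelyContinuousOnInterval
  refine AntitoneOn.absolutelyContinuousOnInterval hab
    (h.continuousOn_angle.mono fun x hx => ⟨ha.1.trans_le hx.1, hx.2.trans_lt hb.2⟩)
    (h.antitone_angle.antitoneOn _) (C := {param u 0, param u 1})
    ((countable_singleton _).insert _) ?_
  rintro t ⟨-, ht⟩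
  simp only [mem_insert_iff, mem_singleton_iff, not_or] at ht
  rcases lt_or_gt_of_ne ht.1 with h1 | h1
  · refine ⟨t - 1, by linarith, param u 0, h1, (hid _ _).of_dist_le fun x hx y hy => ?_⟩
    rw [uIcc_of_le (by linarith)] at hx hy
    rw [h.angle_of_le hx.2, h.angle_of_le hy.2, dist_self]
    exact dist_nonneg
  rcases lt_or_gt_of_ne ht.2 with h2 | h2
  · obtain ⟨c, hc, hct⟩ := exists_between h1
    obtain ⟨d, htd, hd⟩ := exists_between h2
    have hcd := hct.trans htd
    refine ⟨c, hct, d, htd, ?_⟩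
    have h3 : AbsolutelyContinuousOnInterval (deriv u) (h.absc c) (h.absc d) :=
      absolutelyContinuousOnInterval_of_ftc h.reg.ddu_loc h.reg.ftc_du
        (h.absc_mem_Ioo.2 ⟨hc, hcd.trans hd⟩) (h.absc_mem_Ioo.2 ⟨hc.trans hcd, hd⟩)
    refine (AbsolutelyContinuousOnInterval.comp_orderIso h.absc h.dist_absc_le h3).of_dist_le ?_
    intro x hx y hy
    rw [uIcc_of_le hcd.le] at hx hy
    rw [h.angle_of_mem ⟨hc.trans_le hx.1, hx.2.trans_lt hd⟩,
      h.angle_of_mem ⟨hc.trans_le hy.1, hy.2.trans_lt hd⟩]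
    exact Real.dist_arctan_le _ _
  · refine ⟨param u 1, h2, t + 1, by linarith, (hid _ _).of_dist_le fun x hx y hy => ?_⟩
    rw [uIcc_of_le (by linarith)] at hx hy
    rw [h.angle_of_ge hx.1, h.angle_of_ge hy.1, dist_self]
    exact dist_nonneg

end CapProfile

theorem Real.dist_cos_le (x y : ℝ) : dist (Real.cos x) (Real.cos y) ≤ dist x y := by
  simpa using Real.lipschitzWith_cos.dist_le_mul x y

theorem Real.dist_sin_le (x y : ℝ) : dist (Real.sin x) (Real.sin y) ≤ dist x y := by
  simpa using Real.lipschitzWith_sin.dist_le_mul x y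

namespace CapProfile

variable {u : ℝ → ℝ} (h : CapProfile u)

include h

/-- The abscissa of the cap, clamped to `[0,1]`. -/
def capX (t : ℝ) : ℝ := max 0 (min 1 (h.absc t))

/-- The ordinate of the cap. -/
def capY (t : ℝ) : ℝ :=
  u (h.capX t) + len u * min (t - param u 0) 0 - len u * max (t - param u 1) 0

theorem capX_mem (t : ℝ) : h.capX t ∈ Icc (0:ℝ) 1 :=
  ⟨le_max_left _ _, max_le zero_le_one (min_le_left _ _)⟩

theorem capX_of_le {t : ℝ} (ht : t ≤ param u 0) : h.capX t = 0 := by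
  have := h.absc_le_zero.2 ht
  rw [capX, max_eq_left ((min_le_right _ _).trans this)]

theorem capX_of_ge {t : ℝ} (ht : param u 1 ≤ t) : h.capX t = 1 := by
  have := h.one_le_absc.2 ht
  rw [capX, min_eq_left this, max_eq_right zero_le_one]

theorem capX_of_mem {t : ℝ} (ht : t ∈ Ioo (param u 0) (param u 1)) : h.capX t = h.absc t := by
  have := h.absc_mem_Ioo.2 ht
  rw [capX, min_eq_right this.2.le, max_eq_right this.1.le]

theorem capY_of_le {t : ℝ} (ht : t ≤ param u 0) : h.capY t = len u * t := by
  have := h.param_zero_lt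
  rw [capY, h.capX_of_le ht, min_eq_left (by linarith), max_eq_right (by linarith),
    ← h.len_mul_param_zero]
  ring

theorem capY_of_ge {t : ℝ} (ht : param u 1 ≤ t) : h.capY t = len u * (1 - t) := by
  have h1 := h.param_zero_lt
  have h2 := h.len_mul_param_one
  rw [capY, h.capX_of_ge ht, min_eq_right (by linarith), max_eq_left (by linarith)]
  linarith

theorem capY_of_mem {t : ℝ} (ht : t ∈ Ioo (param u 0) (param u 1)) : h.capY t = u (h.absc t) := by
  rw [capY, h.capX_of_mem ht, min_eq_right (by linarith [ht.1]), max_eq_right (by linarith [ht.2])]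
  ring

theorem continuous_capX : Continuous h.capX :=
  continuous_const.max (continuous_const.min h.absc.continuous)

theorem continuous_capY : Continuous h.capY := by
  have h1 : Continuous fun t => u (h.capX t) :=
    h.cont.comp_continuous h.continuous_capX h.capX_mem
  exact (h1.add (continuous_const.mul ((continuous_sub_right _).min continuous_const))).sub
    (continuous_const.mul ((continuous_sub_right _).max continuous_const))

theorem hasDerivAt_capX {t : ℝ} (h0 : t ≠ param u 0) (h1 : t ≠ param u 1) :
    HasDerivAt h.capX (len u * Real.cos (h.angle t)) t := by
  rcases lt_or_gt_of_ne h0 with h0 | h0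
  · rw [h.angle_of_le h0.le, Real.cos_pi_div_two, mul_zero]
    refine (hasDerivAt_const t (0:ℝ)).congr_of_eventuallyEq ?_
    filter_upwards [Iio_mem_nhds h0] with s hs using h.capX_of_le (le_of_lt hs)
  rcases lt_or_gt_of_ne h1 with h1 | h1
  · rw [h.angle_of_mem ⟨h0, h1⟩]
    refine (h.hasDerivAt_absc ⟨h0, h1⟩).congr_of_eventuallyEq ?_
    filter_upwards [Ioo_mem_nhds h0 h1] with s hs using h.capX_of_mem hs
  · rw [h.angle_of_ge h1.le, Real.cos_neg, Real.cos_pi_div_two, mul_zero]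
    refine (hasDerivAt_const t (1:ℝ)).congr_of_eventuallyEq ?_
    filter_upwards [Ioi_mem_nhds h1] with s hs using h.capX_of_ge (le_of_lt hs)

theorem hasDerivAt_capY {t : ℝ} (h0 : t ≠ param u 0) (h1 : t ≠ param u 1) :
    HasDerivAt h.capY (len u * Real.sin (h.angle t)) t := by
  rcases lt_or_gt_of_ne h0 with h0 | h0
  · rw [h.angle_of_le h0.le, Real.sin_pi_div_two]
    refine ((hasDerivAt_id t).const_mul (len u)).congr_of_eventuallyEq ?_
    filter_upwards [Iio_mem_nhds h0] with s hs using h.capY_of_le (le_of_lt hs)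
  rcases lt_or_gt_of_ne h1 with h1 | h1
  · have hx := h.absc_mem_Ioo.2 ⟨h0, h1⟩
    have h2 := (h.diff _ hx).hasDerivAt.comp t (h.hasDerivAt_absc ⟨h0, h1⟩)
    rw [h.angle_of_mem ⟨h0, h1⟩]
    refine (h2.congr_deriv ?_).congr_of_eventuallyEq ?_
    · rw [Real.sin_arctan, Real.cos_arctan]
      ring
    · filter_upwards [Ioo_mem_nhds h0 h1] with s hs using h.capY_of_mem hs
  · rw [h.angle_of_ge h1.le, Real.sin_neg, Real.sin_pi_div_two]
    refine ((((hasDerivAt_id t).const_sub 1).const_mul (len u))).congr_of_eventuallyEq ?_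
    filter_upwards [Ioi_mem_nhds h1] with s hs using h.capY_of_ge (le_of_lt hs)

theorem integrableOn_comp_angle {F : ℝ → ℝ} (hF : Continuous F) (hF1 : ∀ x, |F x| ≤ 1) :
    IntegrableOn (fun t => len u * F (h.angle t)) (Icc 0 1) := by
  refine Integrable.const_mul ?_ _
  refine Measure.integrableOn_of_bounded (M := 1) (by simp)
    (hF.measurable.comp h.antitone_angle.measurable).aestronglyMeasurable ?_
  exact Eventually.of_forall fun t => hF1 _

theorem absolutelyContinuousOnInterval_comp_angle {F : ℝ → ℝ}
    (hF : ∀ x y, dist (F x) (F y) ≤ dist x y) {a b : ℝ} (ha : a ∈ Ioo (0:ℝ) 1)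
    (hb : b ∈ Ioo (0:ℝ) 1) :
    AbsolutelyContinuousOnInterval (fun t => len u * F (h.angle t)) a b :=
  ((h.absolutelyContinuousOnInterval_angle ha hb).of_dist_le fun _ _ _ _ => hF _ _).const_mul _

theorem integrableOn_deriv_comp_angle {F : ℝ → ℝ} (hF : ∀ x y, dist (F x) (F y) ≤ dist x y)
    {a b : ℝ} (ha : 0 < a) (hb : b < 1) :
    IntegrableOn (deriv fun t => len u * F (h.angle t)) (Icc a b) := by
  rcases le_or_gt a b with hab | hab
  · have h1 := (h.absolutelyContinuousOnInterval_comp_angle hF ⟨ha, hab.trans_lt hb⟩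
      ⟨ha.trans_le hab, hb⟩).intervalIntegrable_deriv
    rwa [intervalIntegrable_iff_integrableOn_Icc_of_le hab] at h1
  · simp [Icc_eq_empty (not_le.2 hab)]

theorem eq_add_integral_deriv_comp_angle {F : ℝ → ℝ} (hF : ∀ x y, dist (F x) (F y) ≤ dist x y)
    {a t : ℝ} (ha : a ∈ Ioo (0:ℝ) 1) (ht : t ∈ Ioo (0:ℝ) 1) :
    len u * F (h.angle t) =
      len u * F (h.angle a) + ∫ s in a..t, deriv (fun t => len u * F (h.angle t)) s := by
  rw [(h.absolutelyContinuousOnInterval_comp_angle hF ha ht).integral_deriv_eq_sub]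
  ring

/-- The constant-speed cap: up the line `x = 0`, along the graph of `u`, and down the line
`x = 1`. -/
def curve : Curve where
  x := h.capX
  y := h.capY
  dx t := len u * Real.cos (h.angle t)
  dy t := len u * Real.sin (h.angle t)
  ddx := deriv fun t => len u * Real.cos (h.angle t)
  ddy := deriv fun t => len u * Real.sin (h.angle t)
  dx_int := h.integrableOn_comp_angle Real.continuous_cos Real.abs_cos_le_one
  dy_int := h.integrableOn_comp_angle Real.continuous_sin Real.abs_sin_le_one
  ftc_x t ht := by
    rw [integral_eq_of_hasDerivAt_off_countable_of_le h.capX _ ht.1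
      ((countable_singleton (param u 1)).insert (param u 0)) h.continuous_capX.continuousOn
      (fun s hs => h.hasDerivAt_capX (fun e => hs.2 (by simp [e])) (fun e => hs.2 (by simp [e])))
      ((intervalIntegrable_iff_integrableOn_Icc_of_le ht.1).2
        ((h.integrableOn_comp_angle Real.continuous_cos Real.abs_cos_le_one).mono_set
          (Icc_subset_Icc_right ht.2)))]
    ring
  ftc_y t ht := by
    rw [integral_eq_of_hasDerivAt_off_countable_of_le h.capY _ ht.1
      ((countable_singleton (param u 1)).insert (param u 0)) h.continuous_capY.continuousOn
      (fun s hs => h.hasDerivAt_capY (fun e => hs.2 (by simp [e])) (fun e => hs.2 (by simp [e])))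
      ((intervalIntegrable_iff_integrableOn_Icc_of_le ht.1).2
        ((h.integrableOn_comp_angle Real.continuous_sin Real.abs_sin_le_one).mono_set
          (Icc_subset_Icc_right ht.2)))]
    ring
  ddx_loc _ _ ha hb := h.integrableOn_deriv_comp_angle Real.dist_cos_le ha hb
  ddy_loc _ _ ha hb := h.integrableOn_deriv_comp_angle Real.dist_sin_le ha hb
  ftc_dx _ ha _ ht := h.eq_add_integral_deriv_comp_angle Real.dist_cos_le ha ht
  ftc_dy _ ha _ ht := h.eq_add_integral_deriv_comp_angle Real.dist_sin_le ha ht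

theorem curve_speed (t : ℝ) : speed1 h.curve.toCurve1 t = len u := by
  have : (len u * Real.cos (h.angle t)) ^ 2 + (len u * Real.sin (h.angle t)) ^ 2 = len u ^ 2 := by
    linear_combination (len u) ^ 2 * Real.cos_sq_add_sin_sq (h.angle t)
  simp only [speed1, curve, this]
  exact Real.sqrt_sq h.len_pos.le

theorem mem_Ioo_of_cos_pos {t : ℝ} (ht : 0 < Real.cos (h.angle t)) :
    t ∈ Ioo (param u 0) (param u 1) := by
  constructor
  · by_contra! h1
    rw [h.angle_of_le h1, Real.cos_pi_div_two] at ht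
    exact ht.false
  · by_contra! h1
    rw [h.angle_of_ge h1, Real.cos_neg, Real.cos_pi_div_two] at ht
    exact ht.false

theorem capX_zero : h.capX 0 = 0 := h.capX_of_le h.param_zero_nonneg

theorem capX_one : h.capX 1 = 1 := h.capX_of_ge h.param_one_le

theorem capY_zero : h.capY 0 = 0 := by rw [h.capY_of_le h.param_zero_nonneg, mul_zero]

theorem capY_one : h.capY 1 = 0 := by rw [h.capY_of_ge h.param_one_le, sub_self, mul_zero]

theorem pseudograph_curve : Pseudograph h.curve := by
  have hL := h.len_pos
  refine ⟨⟨len u / 2, by positivity, fun t _ => by rw [h.curve_speed]; linarith⟩, ?_, ?_⟩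
  · intro t _
    exact mul_nonneg hL.le (Real.cos_nonneg_of_mem_Icc (h.angle_mem t))
  · intro a b _ _ _ hpos
    refine ⟨u, deriv u, deriv (deriv u), h.reg.mono (h.capX_mem a).1 (h.capX_mem b).2,
      fun t ht => ?_⟩
    have h1 := h.mem_Ioo_of_cos_pos (pos_of_mul_pos_right (hpos t ht) hL.le)
    exact (congrArg u (h.capX_of_mem h1)).trans (h.capY_of_mem h1).symm

theorem memP_curve {ψ : ℝ → ℝ} (h0 : ψ 0 < 0) (h1 : ψ 1 < 0)
    (hu : ∀ x ∈ Icc (0:ℝ) 1, ψ x ≤ u x) : MemP ψ h.curve := by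
  refine ⟨h.pseudograph_curve, h.capX_zero, h.capY_zero, h.capX_one, h.capY_one, fun t ht => ?_⟩
  have hL := h.len_pos
  change ψ (h.capX t) ≤ h.capY t
  rcases le_or_gt t (param u 0) with h2 | h2
  · rw [h.capX_of_le h2, h.capY_of_le h2]
    exact h0.le.trans (mul_nonneg hL.le ht.1)
  rcases le_or_gt (param u 1) t with h3 | h3
  · rw [h.capX_of_ge h3, h.capY_of_ge h3]
    exact h1.le.trans (mul_nonneg hL.le (sub_nonneg.2 ht.2))
  · rw [h.capX_of_mem ⟨h2, h3⟩, h.capY_of_mem ⟨h2, h3⟩]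
    exact hu _ (Ioo_subset_Icc_self (h.absc_mem_Ioo.2 ⟨h2, h3⟩))

theorem invertible_curve : InvertibleW11On h.capX (param u 0) (param u 1) 0 1 := by
  refine ⟨param u, fun x => weight u x / len u, ?_, fun s _ => ?_, fun t ht => ?_, fun s hs => ?_⟩
  · exact ((intervalIntegrable_iff_integrableOn_Icc_of_le zero_le_one).1
      (h.intervalIntegrable_weight 0 1)).div_const _
  · rw [intervalIntegral.integral_div, ← h.param_sub]
    ring
  · rw [h.capX_of_mem ht]
    exact ⟨h.absc_mem_Ioo.2 ht, h.param_absc t⟩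
  · have h1 : param u s ∈ Ioo (param u 0) (param u 1) :=
      h.absc_mem_Ioo.1 (by rwa [h.absc_param])
    exact ⟨h1, by rw [h.capX_of_mem h1, h.absc_param]⟩

theorem capAbove_curve {γ : Curve} (hu : ∀ t ∈ Icc (0:ℝ) 1, γ.y t ≤ u (γ.x t)) :
    CapAbove h.curve.toCurve1 γ (param u 0) (param u 1) u where
  ep0 := ⟨h.capX_zero, h.capY_zero⟩
  ep1 := ⟨h.capX_one, h.capY_one⟩
  hβ := ⟨h.param_zero_nonneg, h.param_zero_lt, h.param_one_le⟩
  left _ ht := h.capX_of_le ht.2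
  right _ ht := h.capX_of_ge ht.1
  inv := h.invertible_curve
  graph _ ht := (congrArg u (h.capX_of_mem ht)).trans (h.capY_of_mem ht).symm
  ucont := h.cont
  above := hu

/-- The elastic energy density of the cap is that of its tangent angle. -/
theorem elInt_curve_of_hasDerivAt {t k : ℝ} (ht : HasDerivAt h.angle k t) :
    elInt h.curve t = k ^ 2 / len u := by
  have hL := h.len_pos
  have h1 : h.curve.ddx t = len u * (- Real.sin (h.angle t) * k) :=
    (ht.cos.const_mul (len u)).deriv
  have h2 : h.curve.ddy t = len u * (Real.cos (h.angle t) * k) :=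
    (ht.sin.const_mul (len u)).deriv
  have h3 : (len u * Real.cos (h.angle t)) ^ 2 + (len u * Real.sin (h.angle t)) ^ 2 = len u ^ 2 := by
    linear_combination (len u) ^ 2 * Real.cos_sq_add_sin_sq (h.angle t)
  have h4 : len u * Real.cos (h.angle t) * (len u * (Real.cos (h.angle t) * k)) -
      len u * Real.sin (h.angle t) * (len u * (- Real.sin (h.angle t) * k)) = len u ^ 2 * k := by
    linear_combination (len u) ^ 2 * k * Real.cos_sq_add_sin_sq (h.angle t)
  rw [elInt, h1, h2]
  change (len u * Real.cos (h.angle t) * (len u * (Real.cos (h.angle t) * k)) -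
      len u * Real.sin (h.angle t) * (len u * (- Real.sin (h.angle t) * k))) ^ 2 /
      ((len u * Real.cos (h.angle t)) ^ 2 + (len u * Real.sin (h.angle t)) ^ 2) ^ ((5:ℝ) / 2) = _
  rw [h3, h4, ← Real.rpow_natCast (len u) 2, ← Real.rpow_mul hL.le]
  norm_num
  field_simp

theorem ae_differentiableAt_angle : ∀ᵐ t, DifferentiableAt ℝ h.angle t := by
  have h1 : Monotone fun t => - h.angle t := fun s t hst => neg_le_neg (h.antitone_angle hst)
  filter_upwards [h1.ae_differentiableAt] with t ht
  simpa using ht.neg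

theorem elE_curve : elE h.curve =
    ∫⁻ t in Ioo (0:ℝ) 1, ENNReal.ofReal (deriv h.angle t ^ 2 / len u) := by
  refine lintegral_congr_ae (ae_restrict_of_ae ?_)
  filter_upwards [h.ae_differentiableAt_angle] with t ht
  rw [h.elInt_curve_of_hasDerivAt ht.hasDerivAt]

theorem lenE_curve : lenE h.curve = ENNReal.ofReal (len u) := by
  simp [lenE, len1E, h.curve_speed]

end CapProfile

/-! ### Comparison of the elastic energies -/

section energy

variable {ψ : ℝ → ℝ} {γ : Curve} {u : ℝ → ℝ}

theorem elInt_nonneg (γ : Curve) (t : ℝ) : 0 ≤ elInt γ t :=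
  div_nonneg (sq_nonneg _) (Real.rpow_nonneg (by positivity) _)

/-- The parameters at which `γ` meets the graph of `u` over `(0,1)`. -/
def touchSet (γ : Curve) (u : ℝ → ℝ) : Set ℝ :=
  {t | t ∈ Ioo (0:ℝ) 1 ∧ γ.x t ∈ Ioo (0:ℝ) 1 ∧ γ.y t = u (γ.x t)}

theorem measurableSet_touchSet (hu : ContinuousOn u (Icc 0 1)) :
    MeasurableSet (touchSet γ u) := by
  have hO : IsOpen (Ioo (0:ℝ) 1 ∩ γ.x ⁻¹' Ioo 0 1) :=
    (γ.continuousOn_x.mono Ioo_subset_Icc_self).isOpen_inter_preimage isOpen_Ioo isOpen_Ioo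
  have hg : ContinuousOn (fun t => γ.y t - u (γ.x t)) (Ioo (0:ℝ) 1 ∩ γ.x ⁻¹' Ioo 0 1) :=
    (γ.continuousOn_y.mono fun t ht => Ioo_subset_Icc_self ht.1).sub
      (hu.comp (γ.continuousOn_x.mono fun t ht => Ioo_subset_Icc_self ht.1)
        fun t ht => Ioo_subset_Icc_self ht.2)
  have h2 := hg.isOpen_inter_preimage hO (isOpen_compl_singleton (x := (0:ℝ)))
  convert hO.measurableSet.diff h2.measurableSet using 1
  ext t
  simp only [touchSet, mem_ofPred_eq, Set.mem_sdiff, mem_inter_iff, mem_preimage, mem_compl_iff,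
    mem_singleton_iff, sub_eq_zero]
  tauto

open CapProfile in
theorem IsUpperHull.injOn_param (hγ : MemP ψ γ) (hu : IsUpperHull γ.x γ.y u) :
    InjOn (fun t => param u (γ.x t)) (touchSet γ u) := by
  intro s hs t ht hst
  exact hγ.1.eq_of_x_eq (Ioo_subset_Icc_self hs.1) ht.1 (hu.dx_pos hγ ht.1 ht.2.1 ht.2.2)
    ((hu.capProfile hγ).strictMono_param.injective hst)

open CapProfile in
theorem IsUpperHull.hasDerivAt_param_comp (hγ : MemP ψ γ) (hu : IsUpperHull γ.x γ.y u) {t : ℝ}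
    (ht : t ∈ touchSet γ u) : HasDerivAt (fun t => param u (γ.x t))
      (√(1 + deriv u (γ.x t) ^ 2) / len u * γ.dx t) t :=
  ((hu.capProfile hγ).hasDerivAt_param ht.2.1).comp t (γ.hasDerivAt_x ht.1)

open CapProfile in
theorem IsUpperHull.deriv_angle_eq_zero (hγ : MemP ψ γ) (hu : IsUpperHull γ.x γ.y u) {t : ℝ}
    (h0 : t ≠ param u 0) (h1 : t ≠ param u 1)
    (ht : t ∉ (fun t => param u (γ.x t)) '' touchSet γ u) :
    deriv (hu.capProfile hγ).angle t = 0 := by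
  set h := hu.capProfile hγ
  rcases lt_or_gt_of_ne h0 with h0 | h0
  · have : h.angle =ᶠ[𝓝 t] fun _ => Real.pi / 2 := by
      filter_upwards [Iio_mem_nhds h0] with s hs using h.angle_of_le (le_of_lt hs)
    rw [this.deriv_eq, deriv_const]
  rcases lt_or_gt_of_ne h1 with h1 | h1
  · have hx := h.absc_mem_Ioo.2 ⟨h0, h1⟩
    by_cases hK : h.absc t ∈ contactSet γ u
    · obtain ⟨-, τ, hτ, hτx, hτy⟩ := hK
      refine absurd ⟨τ, ⟨hγ.mem_Ioo_of_x_mem hτ (hτx ▸ hx), hτx ▸ hx, hτx ▸ hτy⟩, ?_⟩ ht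
      simp only [hτx, h.param_absc]
    · obtain ⟨c, hc, d, hd, -, -, H⟩ := hu.deriv_eventually_const hγ hx hK
      have : h.angle =ᶠ[𝓝 t] fun _ => Real.arctan (deriv u (h.absc t)) := by
        filter_upwards [Ioo_mem_nhds h0 h1,
          h.absc.continuous.continuousAt.eventually (Icc_mem_nhds hc hd)] with s hs hs'
        rw [h.angle_of_mem hs, H _ hs']
      rw [this.deriv_eq, deriv_const]
  · have : h.angle =ᶠ[𝓝 t] fun _ => - (Real.pi / 2) := by
      filter_upwards [Ioi_mem_nhds h1] with s hs using h.angle_of_ge (le_of_lt hs)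
    rw [this.deriv_eq, deriv_const]

open CapProfile in
/-- At contact points the energy density of the cap, pulled back to `γ`, is at most that of `γ`. -/
theorem IsUpperHull.energy_density_le (hγ : MemP ψ γ) (hu : IsUpperHull γ.x γ.y u) {t : ℝ}
    (ht : t ∈ touchSet γ u) (hacc : 𝓝[touchSet γ u ∩ Ioi t] t ≠ ⊥)
    (hx : HasDerivAt γ.dx (γ.ddx t) t) (hy : HasDerivAt γ.dy (γ.ddy t) t) :
    √(1 + deriv u (γ.x t) ^ 2) / len u * γ.dx t *
      (deriv (hu.capProfile hγ).angle (param u (γ.x t)) ^ 2 / len u) ≤ elInt γ t := by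
  set h := hu.capProfile hγ
  by_cases hd : DifferentiableAt ℝ h.angle (param u (γ.x t))
  swap
  · rw [deriv_zero_of_not_differentiableAt hd]
    simpa using elInt_nonneg γ t
  have hL := h.len_pos
  have hdx := hu.dx_pos hγ ht.1 ht.2.1 ht.2.2
  have hdy := hu.dy_eq_deriv hγ ht.1 ht.2.1 ht.2.2
  have hun : UniqueDiffWithinAt ℝ (touchSet γ u) t := by
    rw [uniqueDiffWithinAt_iff_accPt, accPt_principal_iff_nhdsWithin]
    have : (𝓝[touchSet γ u ∩ Ioi t] t).NeBot := ⟨hacc⟩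
    exact this.mono (nhdsWithin_mono _ fun s hs => ⟨hs.1, (ne_of_gt hs.2)⟩)
  have h1 := (hd.hasDerivAt.comp t (hu.hasDerivAt_param_comp hγ ht)).hasDerivWithinAt
    (s := touchSet γ u)
  have h2 := (hy.div hx hdx.ne').arctan.hasDerivWithinAt (s := touchSet γ u)
  have heq : ∀ s ∈ touchSet γ u, h.angle (param u (γ.x s)) = Real.arctan (γ.dy s / γ.dx s) := by
    intro s hs
    have hs1 : param u (γ.x s) ∈ Ioo (param u 0) (param u 1) :=
      ⟨h.strictMono_param hs.2.1.1, h.strictMono_param hs.2.1.2⟩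
    rw [h.angle_of_mem hs1, h.absc_param, hu.dy_eq_deriv hγ hs.1 hs.2.1 hs.2.2,
      mul_div_cancel_right₀ _ (hu.dx_pos hγ hs.1 hs.2.1 hs.2.2).ne']
  have h3 := hun.eq_deriv _ h1 (h2.congr (fun s hs => heq s hs) (heq t ht))
  set k := deriv h.angle (param u (γ.x t))
  set p := deriv u (γ.x t)
  have hq : 0 < √(1 + p ^ 2) := Real.sqrt_pos.2 (by positivity)
  have hq2 : √(1 + p ^ 2) ^ 2 = 1 + p ^ 2 := Real.sq_sqrt (by positivity)
  set q := √(1 + p ^ 2)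
  have hv : γ.dx t ^ 2 + γ.dy t ^ 2 = (q * γ.dx t) ^ 2 := by
    rw [hdy, mul_pow q, hq2]
    ring
  have hw : γ.dx t * γ.ddy t - γ.dy t * γ.ddx t = k * (q * γ.dx t) ^ 3 / len u := by
    have h4 : 1 + (γ.dy t / γ.dx t) ^ 2 = q ^ 2 := by
      rw [hdy, mul_div_cancel_right₀ _ hdx.ne', hq2]
    simp only [Pi.div_apply] at h3
    rw [h4] at h3
    field_simp at h3 ⊢
    linear_combination - h3
  rw [elInt, hw, hv, ← Real.rpow_natCast (q * γ.dx t) 2, ← Real.rpow_mul (by positivity)]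
  norm_num
  refine le_of_eq ?_
  field_simp

open CapProfile in
theorem IsUpperHull.elE_le (hγ : MemP ψ γ) (hu : IsUpperHull γ.x γ.y u) :
    elE (hu.capProfile hγ).curve ≤ elE γ := by
  set h := hu.capProfile hγ
  have hT := measurableSet_touchSet (γ := γ) hu.cont
  calc elE h.curve
      = ∫⁻ t, (Ioo (0:ℝ) 1).indicator
          (fun t => ENNReal.ofReal (deriv h.angle t ^ 2 / len u)) t := by
        rw [h.elE_curve, lintegral_indicator measurableSet_Ioo]
    _ ≤ ∫⁻ t, ((fun t => param u (γ.x t)) '' touchSet γ u).indicator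
          (fun t => ENNReal.ofReal (deriv h.angle t ^ 2 / len u)) t := by
        refine lintegral_mono_ae ?_
        filter_upwards [compl_mem_ae_iff.2 (measure_singleton (μ := volume) (param u 0)),
          compl_mem_ae_iff.2 (measure_singleton (μ := volume) (param u 1))] with t h0 h1
        by_cases ht : t ∈ (fun t => param u (γ.x t)) '' touchSet γ u
        · rw [indicator_of_mem ht]
          exact indicator_le_self _ _ _
        · rw [indicator_of_notMem ht]
          refine le_of_eq (indicator_apply_eq_zero.2 fun _ => ?_)
          simp [hu.deriv_angle_eq_zero hγ h0 h1 ht]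
    _ ≤ ∫⁻ t in (fun t => param u (γ.x t)) '' touchSet γ u,
          ENNReal.ofReal (deriv h.angle t ^ 2 / len u) := lintegral_indicator_le _ _
    _ = ∫⁻ t in touchSet γ u, ENNReal.ofReal |√(1 + deriv u (γ.x t) ^ 2) / len u * γ.dx t| *
          ENNReal.ofReal (deriv h.angle (param u (γ.x t)) ^ 2 / len u) :=
        lintegral_image_eq_lintegral_abs_deriv_mul hT
          (fun t ht => (hu.hasDerivAt_param_comp hγ ht).hasDerivWithinAt) (hu.injOn_param hγ) _
    _ ≤ ∫⁻ t in touchSet γ u, ENNReal.ofReal (elInt γ t) := by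
        refine lintegral_mono_ae ((ae_restrict_iff' hT).2 ?_)
        filter_upwards [ae_hasDerivAt_of_ftc γ.ddx_loc γ.ftc_dx,
          ae_hasDerivAt_of_ftc γ.ddy_loc γ.ftc_dy,
          compl_mem_ae_iff.2 ((countable_setOfPred_isolated_right_within
            (s := touchSet γ u)).measure_zero volume)] with t hx hy hiso ht
        have hdx := hu.dx_pos hγ ht.1 ht.2.1 ht.2.2
        have hL := h.len_pos
        rw [abs_of_nonneg (by positivity), ← ENNReal.ofReal_mul (by positivity)]
        exact ENNReal.ofReal_le_ofReal (hu.energy_density_le hγ ht (fun hb => hiso ⟨ht, hb⟩)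
          (hx ht.1) (hy ht.1))
    _ ≤ elE γ := lintegral_mono_set fun t ht => ht.1

theorem IsUpperHull.lenE_le (hγ : MemP ψ γ) (hu : IsUpperHull γ.x γ.y u) :
    lenE (hu.capProfile hγ).curve ≤ lenE γ := by
  rw [CapProfile.lenE_curve, lenE, len1E,
    ← ofReal_integral_eq_lintegral_ofReal
      ((γ.integrableOn_speed1).mono_set Ioo_subset_Icc_self)
      (Eventually.of_forall fun t => Real.sqrt_nonneg _)]
  refine ENNReal.ofReal_le_ofReal ((hu.length_le hγ).trans_eq ?_)
  rw [intervalIntegral.integral_of_le zero_le_one, integral_Ioc_eq_integral_Ioo]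

end energy

/-- The energy-efficient `∩`-shape. For every `γ₀ ∈ P_ψ` there is a
`∩`-shaped pseudograph `γ ∈ B_{γ₀}` above `γ₀`, concave on the top, with
`E(γ) ≤ E(γ₀)`, `L(γ) ≤ L(γ₀)` and hence `E_ε(γ) ≤ E_ε(γ₀)` for all `ε ≥ 0`. -/
theorem stmt1 (ψ : ℝ → ℝ) (hψ : Admissible ψ) (γ₀ : Curve) (hγ₀ : MemP ψ γ₀) :
    ∃ (γ : Curve) (β₁ β₂ : ℝ) (u : ℝ → ℝ),
      CapAbove γ.toCurve1 γ₀ β₁ β₂ u ∧ MemP ψ γ ∧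
      ConcaveOn ℝ (Icc (0:ℝ) 1) u ∧
      elE γ ≤ elE γ₀ ∧ lenE γ ≤ lenE γ₀ ∧
      ∀ ε : ℝ, 0 ≤ ε → penE ε γ ≤ penE ε γ₀ := by
  obtain ⟨u, hu⟩ := exists_isUpperHull γ₀.continuousOn_x γ₀.continuousOn_y hγ₀.2.1
    hγ₀.2.2.2.1 hγ₀.2.2.1 hγ₀.2.2.2.2.1 fun t ht => hγ₀.x_mem ht
  have hψu : ∀ x ∈ Icc (0:ℝ) 1, ψ x ≤ u x := by
    intro x hx
    obtain ⟨t, ht, rfl⟩ : x ∈ γ₀.x '' Icc 0 1 := by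
      refine intermediate_value_Icc zero_le_one γ₀.continuousOn_x ?_
      rwa [hγ₀.2.1, hγ₀.2.2.2.1]
    exact (hγ₀.2.2.2.2.2 t ht).trans (hu.above t ht)
  have hE := hu.elE_le hγ₀
  have hL := hu.lenE_le hγ₀
  exact ⟨(hu.capProfile hγ₀).curve, _, _, u, (hu.capProfile hγ₀).capAbove_curve hu.above,
    (hu.capProfile hγ₀).memP_curve hψ.neg0 hψ.neg1 hψu, hu.concave, hE, hL,
    fun ε _ => add_le_add hE (mul_le_mul_right hL _)⟩
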